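/- arXiv:2105.02827 — 6 statements merged into one kernel-verified Lean document; each statement's English description precedes it below -/
import Mathlib

section
/- Let W̃ be a finite set of items each with width in (1/2, 1] and positive height (heights may exceed 1), and let H̃ be a finite set of items each with height in (1/2, 1] and positive width (widths may exceed 1). Then there exist a horizontal slicing of each item of W̃, a vertical slicing of each item of H̃, and a packing of all the resulting slices into at most max( ⌈∑_{i∈W̃} h(i)⌉, ⌈∑_{i∈H̃} w(i)⌉, (4/3)·a(W̃ ∪ H̃) + 8/3 ) unit square bins. -/
/-- An axis-aligned, non-rotated packing of items (item `i` has width `w i`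
and height `h i`) into `N` unit square bins: each item gets a bin index and
coordinates for its bottom-left corner, each item lies inside its bin, and
the interiors of any two items placed in the same bin are disjoint. -/
structure BinPacking {ι : Type} [Fintype ι] (w h : ι → ℝ) (N : ℕ) where
  bin : ι → Fin N
  x : ι → ℝ
  y : ι → ℝ
  x_nonneg : ∀ i, 0 ≤ x i
  y_nonneg : ∀ i, 0 ≤ y i
  x_add_le : ∀ i, x i + w i ≤ 1
  y_add_le : ∀ i, y i + h i ≤ 1
  disj : ∀ i j, i ≠ j → bin i = bin j →
    (Set.Ioo (x i) (x i + w i) ×ˢ Set.Ioo (y i) (y i + h i)) ∩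
      (Set.Ioo (x j) (x j + w j) ×ˢ Set.Ioo (y j) (y j + h j)) = ∅

/-- The minimum number of unit square bins needed to pack the items. -/
noncomputable def opt {ι : Type} [Fintype ι] (w h : ι → ℝ) : ℕ :=
  sInf {N | Nonempty (BinPacking w h N)}

/-- Amounts `u i ≥ 0` of items with sizes `w i`, where the sizes are at least `1/2` and the sizes
of the items actually present are at most `a ≤ 1`. -/
structure IsResidual {n : ℕ} (w u : Fin n → ℝ) (a : ℝ) : Prop where
  nonneg : ∀ i, 0 ≤ u i
  half_le_size : ∀ i, 1/2 ≤ w i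
  half_le : 1/2 ≤ a
  le_one : a ≤ 1
  size_le : ∀ i, 0 < u i → w i ≤ a

/-- A sufficient condition for wide slices of heights `u` (stacked from height `y₀` on) and tall
slices of widths `v` (placed side by side from abscissa `x₀` on) to fit in one unit bin. -/
def FitsBin {n m : ℕ} (w : Fin n → ℝ) (h : Fin m → ℝ) (u : Fin n → ℝ) (v : Fin m → ℝ)
    (x₀ y₀ : ℝ) : Prop :=
  (∀ i, 0 ≤ u i) ∧ (∀ j, 0 ≤ v j) ∧ 0 ≤ x₀ ∧ 0 ≤ y₀ ∧ ∑ i, u i + y₀ ≤ 1 ∧ ∑ j, v j + x₀ ≤ 1 ∧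
    ((∀ i, 0 < u i → w i ≤ x₀) ∨ (∀ j, 0 < v j → h j ≤ y₀))

/-- The amounts `u` and `v` can be distributed over `N` bins, each satisfying `FitsBin`. -/
def Distributes {n m : ℕ} (w : Fin n → ℝ) (h : Fin m → ℝ) (u : Fin n → ℝ) (v : Fin m → ℝ)
    (N : ℕ) : Prop :=
  ∃ (U : Fin N → Fin n → ℝ) (V : Fin N → Fin m → ℝ) (x₀ y₀ : Fin N → ℝ),
    (∀ i, ∑ k, U k i = u i) ∧ (∀ j, ∑ k, V k j = v j) ∧
    ∀ k, FitsBin w h (U k) (V k) (x₀ k) (y₀ k)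

theorem FitsBin.swap {n m : ℕ} {w : Fin n → ℝ} {h : Fin m → ℝ} {u : Fin n → ℝ} {v : Fin m → ℝ}
    {x₀ y₀ : ℝ} (H : FitsBin w h u v x₀ y₀) : FitsBin h w v u y₀ x₀ := by
  obtain ⟨h1, h2, h3, h4, h5, h6, h7⟩ := H
  exact ⟨h2, h1, h4, h3, h6, h5, h7.symm⟩

theorem Distributes.swap {n m : ℕ} {w : Fin n → ℝ} {h : Fin m → ℝ} {u : Fin n → ℝ}
    {v : Fin m → ℝ} {N : ℕ} (H : Distributes w h u v N) : Distributes h w v u N := by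
  obtain ⟨U, V, x₀, y₀, h1, h2, h3⟩ := H
  exact ⟨V, U, y₀, x₀, h2, h1, fun k => (h3 k).swap⟩

theorem Distributes.cons {n m : ℕ} {w : Fin n → ℝ} {h : Fin m → ℝ} {u u₁ u₂ : Fin n → ℝ}
    {v v₁ v₂ : Fin m → ℝ} {N : ℕ} {x₀ y₀ : ℝ} (H : FitsBin w h u₁ v₁ x₀ y₀)
    (hu : ∀ i, u₁ i + u₂ i = u i) (hv : ∀ j, v₁ j + v₂ j = v j)
    (H₂ : Distributes w h u₂ v₂ N) : Distributes w h u v (N + 1) := by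
  obtain ⟨U, V, X, Y, h1, h2, h3⟩ := H₂
  refine ⟨Fin.cons u₁ U, Fin.cons v₁ V, Fin.cons x₀ X, Fin.cons y₀ Y, fun i => ?_, fun j => ?_,
    fun k => ?_⟩
  · simp [Fin.sum_univ_succ, h1, hu]
  · simp [Fin.sum_univ_succ, h2, hv]
  · refine Fin.cases ?_ (fun k => ?_) k
    · simpa using H
    · simpa using h3 k

theorem FitsBin.distributes {n m : ℕ} {w : Fin n → ℝ} {h : Fin m → ℝ} {u : Fin n → ℝ}
    {v : Fin m → ℝ} {x₀ y₀ : ℝ} (H : FitsBin w h u v x₀ y₀) : Distributes w h u v 1 :=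
  ⟨fun _ => u, fun _ => v, fun _ => x₀, fun _ => y₀, by simp, by simp, fun _ => H⟩

/-- Greedily taking an amount `t` of the items in `s`, largest sizes first. -/
theorem exists_greedy_on {n : ℕ} (w u : Fin n → ℝ) (hu : ∀ i, 0 ≤ u i) (lo : ℝ)
    (s : Finset (Fin n)) :
    ∀ hi t : ℝ, lo ≤ hi → (∀ i ∈ s, lo ≤ w i) → (∀ i ∈ s, w i ≤ hi) → 0 ≤ t → t ≤ ∑ i ∈ s, u i →
      ∃ (u₁ : Fin n → ℝ) (c : ℝ), lo ≤ c ∧ c ≤ hi ∧ (∀ i, 0 ≤ u₁ i) ∧ (∀ i, u₁ i ≤ u i) ∧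
        (∀ i, i ∉ s → u₁ i = 0) ∧ ∑ i ∈ s, u₁ i = t ∧
        (∀ i ∈ s, u₁ i < u i → w i ≤ c) ∧ (∀ i ∈ s, 0 < u₁ i → c ≤ w i) := by
  induction s using Finset.induction_on_max_value w with
  | empty =>
    intro hi t hlh _ _ h0 h1
    simp at h1
    exact ⟨fun _ => 0, lo, le_rfl, hlh, by simp, by simpa using hu, by simp,
      by simp; linarith, by simp, by simp⟩
  | insert a s has hmax ih =>
    intro hi t hlh hlo hhi h0 h1
    rw [Finset.sum_insert has] at h1
    rcases le_or_gt t (u a) with hta | hta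
    · refine ⟨Function.update 0 a t, w a, hlo a (by simp), hhi a (by simp), fun i => ?_,
        fun i => ?_, fun i hi => ?_, ?_, fun i hi _ => ?_, fun i hi hpos => ?_⟩
      · by_cases hia : i = a
        · subst hia; simpa
        · simp [hia]
      · by_cases hia : i = a
        · subst hia; simpa
        · simpa [hia] using hu i
      · have hia : i ≠ a := fun hia => hi (by simp [hia])
        simp [hia]
      · rw [Finset.sum_insert has, Finset.sum_eq_zero]
        · simp
        · intro i hi
          have hia : i ≠ a := fun hia => has (hia ▸ hi)
          simp [hia]
      · rcases Finset.mem_insert.1 hi with rfl | hi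
        · exact le_rfl
        · exact hmax i hi
      · by_cases hia : i = a
        · rw [hia]
        · simp [hia] at hpos
    · obtain ⟨u₁, c, hc1, hc2, hn, hle, hout, hsum, hA, hB⟩ := ih (w a) (t - u a)
        (hlo a (by simp)) (fun i hi => hlo i (by simp [hi])) hmax (by linarith) (by linarith)
      refine ⟨Function.update u₁ a (u a), c, hc1, hc2.trans (hhi a (by simp)), fun i => ?_,
        fun i => ?_, fun i hi => ?_, ?_, fun i hi hlt => ?_, fun i hi hpos => ?_⟩
      · by_cases hia : i = a
        · subst hia; simpa using hu i
        · simpa [hia] using hn i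
      · by_cases hia : i = a
        · subst hia; simp
        · simpa [hia] using hle i
      · have hia : i ≠ a := fun hia => hi (by simp [hia])
        simpa [hia] using hout i (fun h => hi (by simp [h]))
      · rw [Finset.sum_insert has, Finset.sum_congr rfl (g := u₁)]
        · simp; linarith
        · intro i hi
          have hia : i ≠ a := fun hia => has (hia ▸ hi)
          simp [hia]
      · by_cases hia : i = a
        · subst hia; simp at hlt
        · rcases Finset.mem_insert.1 hi with h | h
          · exact absurd h hia
          · exact hA i h (by simpa [hia] using hlt)
      · by_cases hia : i = a
        · rw [hia]; exact hc2
        · rcases Finset.mem_insert.1 hi with h | h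
          · exact absurd h hia
          · exact hB i h (by simpa [hia] using hpos)

/-- An amount `t` can be removed so that the size bound `c` of what remains is also a lower bound
for the average size of what is removed. -/
theorem IsResidual.exists_greedy {n : ℕ} {w u : Fin n → ℝ} {a : ℝ} (H : IsResidual w u a) {t : ℝ}
    (ht : 0 ≤ t) (htu : t ≤ ∑ i, u i) :
    ∃ (u₁ u₂ : Fin n → ℝ) (c : ℝ), IsResidual w u₁ a ∧ IsResidual w u₂ c ∧ c ≤ a ∧
      (∀ i, u₁ i + u₂ i = u i) ∧ ∑ i, u₁ i = t ∧ ∑ i, u₂ i = ∑ i, u i - t ∧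
      ∑ i, w i * u₂ i + c * t ≤ ∑ i, w i * u i := by
  have hsupp : ∀ f : Fin n → ℝ, (∀ i, ¬ 0 < u i → f i = 0) →
      ∑ i ∈ Finset.univ.filter (fun i => 0 < u i), f i = ∑ i, f i := by
    intro f hf
    rw [Finset.sum_filter]
    refine Finset.sum_congr rfl fun i _ => ?_
    split_ifs with hi
    · rfl
    · exact (hf i hi).symm
  have hu0 : ∀ i, ¬ 0 < u i → u i = 0 := fun i hi => le_antisymm (not_lt.1 hi) (H.nonneg i)
  obtain ⟨u₁, c, hc1, hc2, hn, hle, hout, hsum, hA, hB⟩ :=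
    exists_greedy_on w u H.nonneg (1/2) (Finset.univ.filter (fun i => 0 < u i)) a t H.half_le
      (fun i _ => H.half_le_size i) (fun i hi => H.size_le i (by simpa using hi)) ht
      (by rwa [hsupp u hu0])
  rw [hsupp u₁ (fun i hi => hout i (by simpa using hi))] at hsum
  refine ⟨u₁, fun i => u i - u₁ i, c,
    ⟨hn, H.half_le_size, H.half_le, H.le_one, fun i hi => H.size_le i (hi.trans_le (hle i))⟩,
    ⟨fun i => sub_nonneg.2 (hle i), H.half_le_size, hc1, hc2.trans H.le_one, fun i hi => ?_⟩,
    hc2, fun i => by ring, hsum, by rw [Finset.sum_sub_distrib, hsum], ?_⟩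
  · have hlt : u₁ i < u i := by linarith
    exact hA i (by simpa using (hn i).trans_lt hlt) hlt
  · rw [← hsum, Finset.mul_sum, ← Finset.sum_add_distrib]
    refine Finset.sum_le_sum fun i _ => ?_
    rcases (hn i).eq_or_lt with h0 | h0
    · simp [← h0]
    · nlinarith [mul_le_mul_of_nonneg_right
        (hB i (by simpa using h0.trans_le (hle i)) h0) h0.le]

/-- If the tall items fit next to a full stack of wide items, then only the total height of the
wide items matters. -/
theorem distributes_of_sum_le {n m : ℕ} {w : Fin n → ℝ} {h : Fin m → ℝ} {v : Fin m → ℝ} {a b : ℝ}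
    (Hv : IsResidual h v b) (hva : ∑ j, v j ≤ 1 - a) (N : ℕ) :
    ∀ u : Fin n → ℝ, IsResidual w u a → ∑ i, u i ≤ N + 1 → Distributes w h u v (N + 1) := by
  induction N with
  | zero =>
    intro u Hu hs
    have hfit : FitsBin w h u v a 0 :=
      ⟨Hu.nonneg, Hv.nonneg, by linarith [Hu.half_le], le_rfl, by simpa using hs, by linarith,
        Or.inl Hu.size_le⟩
    exact hfit.distributes
  | succ N ih =>
    intro u Hu hs
    obtain ⟨u₁, u₂, c, H1, H2, hca, hadd, hs1, hs2, -⟩ :=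
      Hu.exists_greedy (t := min 1 (∑ i, u i))
        (le_min zero_le_one (Finset.sum_nonneg fun i _ => Hu.nonneg i)) (min_le_right _ _)
    have hfit : FitsBin w h u₁ 0 a 0 :=
      ⟨H1.nonneg, by simp, by linarith [Hu.half_le], le_rfl,
        by rw [hs1, add_zero]; exact min_le_left _ _, by simpa using Hu.le_one, Or.inl H1.size_le⟩
    refine Distributes.cons hfit hadd (by simp) (ih u₂ ⟨H2.nonneg, H2.half_le_size, Hu.half_le,
      Hu.le_one, fun i hi => (H2.size_le i hi).trans hca⟩ ?_)
    rw [hs2]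
    push_cast at hs
    rcases min_cases 1 (∑ i, u i) with h | h
    · linarith
    · have : (0 : ℝ) ≤ N := N.cast_nonneg
      linarith

/-- Packing one bin with a full stack of the widest items and, next to it, the tallest items. -/
theorem exists_full_bin {n m : ℕ} {w u : Fin n → ℝ} {h v : Fin m → ℝ} {a b : ℝ}
    (Hu : IsResidual w u a) (Hv : IsResidual h v b) (hu1 : 1 ≤ ∑ i, u i)
    (hva : 1 - a ≤ ∑ j, v j) :
    ∃ (u₂ : Fin n → ℝ) (v₂ : Fin m → ℝ) (a' b' : ℝ), IsResidual w u₂ a' ∧ IsResidual h v₂ b' ∧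
      ∑ i, u₂ i = ∑ i, u i - 1 ∧ ∑ j, v₂ j = ∑ j, v j - (1 - a) ∧
      (∑ i, w i * u₂ i + ∑ j, h j * v₂ j) + (a' + b') + 3/4 ≤
        (∑ i, w i * u i + ∑ j, h j * v j) + (a + b) ∧
      ∀ N, Distributes w h u₂ v₂ N → Distributes w h u v (N + 1) := by
  obtain ⟨u₁, u₂, a', H1, H2, ha, hadd, hs1, hs2, harea⟩ := Hu.exists_greedy zero_le_one hu1
  obtain ⟨v₁, v₂, b', K1, K2, hb, kadd, ks1, ks2, karea⟩ :=
    Hv.exists_greedy (sub_nonneg.2 Hu.le_one) hva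
  refine ⟨u₂, v₂, a', b', H2, K2, hs2, ks2, ?_, fun N => Distributes.cons (x₀ := a) (y₀ := 0)
    ⟨H1.nonneg, K1.nonneg, by linarith [Hu.half_le], le_rfl, by linarith, by linarith,
      Or.inl H1.size_le⟩ hadd kadd⟩
  have h1 := Hu.half_le
  have h2 := Hv.half_le
  have h3 := Hu.le_one
  nlinarith [mul_nonneg (sub_nonneg.2 h1) (sub_nonneg.2 hb),
    mul_nonneg (sub_nonneg.2 h3) (sub_nonneg.2 h2)]

theorem IsResidual.half_sum_le {n : ℕ} {w u : Fin n → ℝ} {a : ℝ} (H : IsResidual w u a) :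
    1/2 * ∑ i, u i ≤ ∑ i, w i * u i := by
  rw [Finset.mul_sum]
  exact Finset.sum_le_sum fun i _ => mul_le_mul_of_nonneg_right (H.half_le_size i) (H.nonneg i)

/-- If the total height of the wide items and the total width of the tall items differ by at most
one, then the area bound holds. -/
theorem exists_distributes_of_balanced (T : ℕ) :
    ∀ {n m : ℕ} {w u : Fin n → ℝ} {h v : Fin m → ℝ} {a b : ℝ}, IsResidual w u a →
      IsResidual h v b → ∑ i, u i ≤ ∑ j, v j + 1 → ∑ j, v j ≤ ∑ i, u i + 1 →
      ∑ i, u i + ∑ j, v j < T →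
      ∃ N : ℕ, Distributes w h u v N ∧
        (N : ℝ) ≤ 4/3 * (∑ i, w i * u i + ∑ j, h j * v j) + 4/3 * (a + b) := by
  induction T with
  | zero =>
    intro n m w u h v a b Hu Hv _ _ hT
    have h1 := Finset.sum_nonneg fun i (_ : i ∈ Finset.univ) => Hu.nonneg i
    have h2 := Finset.sum_nonneg fun j (_ : j ∈ Finset.univ) => Hv.nonneg j
    simp only [Nat.cast_zero] at hT
    linarith
  | succ T ih =>
    have key : ∀ {n m : ℕ} {w u : Fin n → ℝ} {h v : Fin m → ℝ} {a b : ℝ}, IsResidual w u a →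
        IsResidual h v b → ∑ i, u i ≤ ∑ j, v j + 1 → ∑ j, v j ≤ ∑ i, u i →
        ∑ i, u i + ∑ j, v j < (T + 1 : ℕ) →
        ∃ N : ℕ, Distributes w h u v N ∧
          (N : ℝ) ≤ 4/3 * (∑ i, w i * u i + ∑ j, h j * v j) + 4/3 * (a + b) := by
      intro n m w u h v a b Hu Hv hd hle hT
      have hu0 := Finset.sum_nonneg fun i (_ : i ∈ Finset.univ) => Hu.nonneg i
      have hv0 := Finset.sum_nonneg fun j (_ : j ∈ Finset.univ) => Hv.nonneg j
      have hAu := Hu.half_sum_le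
      have hAv := Hv.half_sum_le
      have ha := Hu.half_le
      have hb := Hv.half_le
      have ha1 := Hu.le_one
      have hb1 := Hv.le_one
      push_cast at hT
      rcases le_or_gt (∑ i, u i) 1 with hu1 | hu1
      · rcases le_or_gt (∑ j, v j) (1 - a) with hva | hva
        · exact ⟨1, distributes_of_sum_le Hv hva 0 u Hu (by simpa using hu1),
            by push_cast; linarith⟩
        rcases le_or_gt (∑ i, u i) (1 - b) with hub | hub
        · exact ⟨1, (distributes_of_sum_le Hu hub 0 v Hv (by simp; linarith)).swap,
            by push_cast; linarith⟩
        refine ⟨2, Distributes.cons (u₁ := u) (v₁ := 0) (u₂ := 0) (v₂ := v) (x₀ := 1) (y₀ := 0)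
          ⟨Hu.nonneg, by simp, zero_le_one, le_rfl, by simpa using hu1, by simp,
            Or.inl fun i hi => (Hu.size_le i hi).trans ha1⟩ (by simp) (by simp)
          (FitsBin.distributes (x₀ := 0) (y₀ := 1)
            ⟨by simp, Hv.nonneg, le_rfl, zero_le_one, by simp, by linarith,
            Or.inr fun j hj => (Hv.size_le j hj).trans hb1⟩), ?_⟩
        push_cast
        linarith
      · rcases le_or_gt (∑ j, v j) (1 - a) with hva | hva
        · exact ⟨2, distributes_of_sum_le Hv hva 1 u Hu (by push_cast; linarith),
            by push_cast; linarith⟩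
        obtain ⟨u₂, v₂, a', b', Hu₂, Hv₂, hs, ks, harea, hN⟩ :=
          exists_full_bin Hu Hv hu1.le hva.le
        obtain ⟨N, hD, hNle⟩ := ih Hu₂ Hv₂ (by linarith) (by linarith) (by linarith)
        exact ⟨N + 1, hN N hD, by push_cast; linarith⟩
    intro n m w u h v a b Hu Hv h1 h2 hT
    rcases le_total (∑ j, v j) (∑ i, u i) with hle | hle
    · exact key Hu Hv h1 hle hT
    · obtain ⟨N, hD, hN⟩ := key Hv Hu h2 hle (by linarith)
      exact ⟨N, hD.swap, by linarith⟩

theorem exists_distributes_of_sum_le (T : ℕ) :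
    ∀ {n m : ℕ} {w u : Fin n → ℝ} {h v : Fin m → ℝ} {a b : ℝ}, IsResidual w u a →
      IsResidual h v b → ∑ j, v j ≤ ∑ i, u i → ∑ i, u i + ∑ j, v j < T →
      ∃ N : ℕ, Distributes w h u v N ∧ ((N : ℝ) ≤ (⌈∑ i, u i⌉ : ℤ) ∨
        (N : ℝ) ≤ 4/3 * (∑ i, w i * u i + ∑ j, h j * v j) + 4/3 * (a + b)) := by
  induction T with
  | zero =>
    intro n m w u h v a b Hu Hv _ hT
    have h1 := Finset.sum_nonneg fun i (_ : i ∈ Finset.univ) => Hu.nonneg i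
    have h2 := Finset.sum_nonneg fun j (_ : j ∈ Finset.univ) => Hv.nonneg j
    simp only [Nat.cast_zero] at hT
    linarith
  | succ T ih =>
    intro n m w u h v a b Hu Hv hle hT
    have hv0 := Finset.sum_nonneg fun j (_ : j ∈ Finset.univ) => Hv.nonneg j
    have ha := Hu.half_le
    have ha1 := Hu.le_one
    rcases le_or_gt (∑ i, u i) (∑ j, v j + 1) with hd | hd
    · obtain ⟨N, hD, hN⟩ := exists_distributes_of_balanced _ Hu Hv hd (by linarith) hT
      exact ⟨N, hD, Or.inr hN⟩
    rcases le_or_gt (∑ j, v j) (1 - a) with hva | hva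
    · obtain ⟨N, hN⟩ : ∃ N : ℕ, ⌈∑ i, u i⌉ = N + 1 := by
        have h1 : (0 : ℤ) < ⌈∑ i, u i⌉ := Int.ceil_pos.2 (by linarith)
        exact ⟨(⌈∑ i, u i⌉ - 1).toNat, by omega⟩
      have hc := Int.le_ceil (∑ i, u i)
      rw [hN] at hc ⊢
      exact ⟨N + 1, distributes_of_sum_le Hv hva N u Hu (by exact_mod_cast hc),
        Or.inl (by push_cast; exact le_rfl)⟩
    · push_cast at hT
      obtain ⟨u₂, v₂, a', b', Hu₂, Hv₂, hs, ks, harea, hN⟩ :=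
        exists_full_bin Hu Hv (by linarith) hva.le
      obtain ⟨N, hD, hNle⟩ := ih Hu₂ Hv₂ (by linarith) (by linarith)
      refine ⟨N + 1, hN N hD, hNle.imp (fun h => ?_) (fun h => ?_)⟩
      · rw [hs, Int.ceil_sub_one] at h
        push_cast at h ⊢
        linarith
      · push_cast
        linarith

theorem sum_Iio_add_le_sum_Iio {n : ℕ} {f : Fin n → ℝ} (hf : ∀ i, 0 ≤ f i) {i j : Fin n}
    (hij : i < j) : ∑ k ∈ Finset.Iio i, f k + f i ≤ ∑ k ∈ Finset.Iio j, f k := by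
  rw [add_comm, ← Finset.sum_insert (by simp)]
  refine Finset.sum_le_sum_of_subset_of_nonneg (fun k hk => ?_) fun k _ _ => hf k
  rcases Finset.mem_insert.1 hk with rfl | hk
  · simpa using hij
  · simpa using (Finset.mem_Iio.1 hk).trans hij

theorem sum_Iio_add_le_sum {n : ℕ} {f : Fin n → ℝ} (hf : ∀ i, 0 ≤ f i) (i : Fin n) :
    ∑ k ∈ Finset.Iio i, f k + f i ≤ ∑ k, f k := by
  rw [add_comm, ← Finset.sum_insert (by simp)]
  exact Finset.sum_le_sum_of_subset_of_nonneg (Finset.subset_univ _) fun k _ _ => hf k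

theorem Ioo_prod_inter_Ioo_prod_eq_empty {x w y h x' w' y' h' : ℝ}
    (H : (x + w ≤ x' ∨ x' + w' ≤ x) ∨ (y + h ≤ y' ∨ y' + h' ≤ y)) :
    (Set.Ioo x (x + w) ×ˢ Set.Ioo y (y + h)) ∩
      (Set.Ioo x' (x' + w') ×ˢ Set.Ioo y' (y' + h')) = ∅ := by
  ext ⟨p, q⟩
  simp only [Set.mem_inter_iff, Set.mem_prod, Set.mem_Ioo, Set.mem_empty_iff_false, iff_false]
  rintro ⟨⟨⟨h1, h2⟩, h3, h4⟩, ⟨h5, h6⟩, h7, h8⟩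
  rcases H with (H | H) | (H | H) <;> linarith

/-- The nonempty slices of a distribution over bins. -/
abbrev Slice {N n : ℕ} (U : Fin N → Fin n → ℝ) : Type :=
  {p : Fin N × Fin n // 0 < U p.1 p.2}

theorem sum_slices_eq {N n k : ℕ} {U : Fin N → Fin n → ℝ} (hU : ∀ k i, 0 ≤ U k i)
    (e : Fin k ≃ Slice U) (j : Fin n) :
    ∑ s ∈ Finset.univ.filter (fun s => (e s).1.2 = j), U (e s).1.1 (e s).1.2 = ∑ l, U l j := by
  rw [Finset.sum_filter, e.sum_comp (fun p : Slice U => if p.1.2 = j then U p.1.1 p.1.2 else 0),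
    ← Finset.sum_subtype (Finset.univ.filter fun p : Fin N × Fin n => 0 < U p.1 p.2) (by simp)
      (fun p : Fin N × Fin n => if p.2 = j then U p.1 p.2 else 0),
    Finset.sum_filter, Fintype.sum_prod_type]
  refine Finset.sum_congr rfl fun l _ => ?_
  rw [Finset.sum_eq_single j]
  · rcases (hU l j).eq_or_lt with h | h
    · simp [← h]
    · simp [h]
  · intro i _ hij
    simp [hij]
  · simp

/-- The packing of the slices of a distribution over bins. -/
theorem nonempty_binPacking_of_fitsBin {n m N k l : ℕ} {w : Fin n → ℝ} {h : Fin m → ℝ}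
    (hw : ∀ i, w i ≤ 1) (hh : ∀ j, h j ≤ 1)
    {U : Fin N → Fin n → ℝ} {V : Fin N → Fin m → ℝ} {x₀ y₀ : Fin N → ℝ}
    (H : ∀ k, FitsBin w h (U k) (V k) (x₀ k) (y₀ k)) (e : Fin k ≃ Slice U) (f : Fin l ≃ Slice V) :
    Nonempty (BinPacking (Sum.elim (fun s => w (e s).1.2) (fun s => V (f s).1.1 (f s).1.2))
      (Sum.elim (fun s => U (e s).1.1 (e s).1.2) (fun s => h (f s).1.2)) N) := by
  have hU : ∀ k i, 0 ≤ U k i := fun k => (H k).1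
  have hV : ∀ k i, 0 ≤ V k i := fun k => (H k).2.1
  have hcross : ∀ (s : Fin k) (t : Fin l), (e s).1.1 = (f t).1.1 →
      w (e s).1.2 ≤ x₀ (f t).1.1 + ∑ j ∈ Finset.Iio (f t).1.2, V (f t).1.1 j ∨
      h (f t).1.2 ≤ y₀ (e s).1.1 + ∑ i ∈ Finset.Iio (e s).1.2, U (e s).1.1 i := by
    intro s t hst
    have h1 : 0 ≤ ∑ j ∈ Finset.Iio (f t).1.2, V (f t).1.1 j := Finset.sum_nonneg fun j _ => hV _ j
    have h2 : 0 ≤ ∑ i ∈ Finset.Iio (e s).1.2, U (e s).1.1 i := Finset.sum_nonneg fun i _ => hU _ i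
    rcases (H (e s).1.1).2.2.2.2.2.2 with hx | hy
    · have := hx _ (e s).2
      rw [hst] at this
      left
      linarith
    · have := hy (f t).1.2 (by rw [hst]; exact (f t).2)
      right
      linarith
  refine ⟨{
    bin := Sum.elim (fun s => (e s).1.1) (fun s => (f s).1.1)
    x := Sum.elim (fun _ => 0)
      (fun s => x₀ (f s).1.1 + ∑ j ∈ Finset.Iio (f s).1.2, V (f s).1.1 j)
    y := Sum.elim (fun s => y₀ (e s).1.1 + ∑ i ∈ Finset.Iio (e s).1.2, U (e s).1.1 i)
      (fun _ => 0)
    x_nonneg := ?_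
    y_nonneg := ?_
    x_add_le := ?_
    y_add_le := ?_
    disj := ?_ }⟩
  · rintro (s | s)
    · exact le_rfl
    · exact add_nonneg (H _).2.2.1 (Finset.sum_nonneg fun j _ => hV _ j)
  · rintro (s | s)
    · exact add_nonneg (H _).2.2.2.1 (Finset.sum_nonneg fun j _ => hU _ j)
    · exact le_rfl
  · rintro (s | s)
    · simpa using hw _
    · have := sum_Iio_add_le_sum (hV (f s).1.1) (f s).1.2
      have := (H (f s).1.1).2.2.2.2.2.1
      simp only [Sum.elim_inr]
      linarith
  · rintro (s | s)
    · have := sum_Iio_add_le_sum (hU (e s).1.1) (e s).1.2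
      have := (H (e s).1.1).2.2.2.2.1
      simp only [Sum.elim_inl]
      linarith
    · simpa using hh _
  · rintro (s | s) (t | t) hne hbin <;> simp only [Sum.elim_inl, Sum.elim_inr] at hbin ⊢ <;>
      apply Ioo_prod_inter_Ioo_prod_eq_empty
    · right
      have hne' : (e s).1.2 ≠ (e t).1.2 := fun h' =>
        hne (congrArg Sum.inl (e.injective (Subtype.ext (Prod.ext hbin h'))))
      rw [hbin]
      rcases lt_or_gt_of_ne hne' with hlt | hlt
      · left
        linarith [sum_Iio_add_le_sum_Iio (hU (e t).1.1) hlt]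
      · right
        linarith [sum_Iio_add_le_sum_Iio (hU (e t).1.1) hlt]
    · rcases hcross s t hbin with h1 | h1
      · exact Or.inl (Or.inl (by linarith))
      · exact Or.inr (Or.inr (by linarith))
    · rcases hcross t s hbin.symm with h1 | h1
      · exact Or.inl (Or.inr (by linarith))
      · exact Or.inr (Or.inl (by linarith))
    · left
      have hne' : (f s).1.2 ≠ (f t).1.2 := fun h' =>
        hne (congrArg Sum.inr (f.injective (Subtype.ext (Prod.ext hbin h'))))
      rw [hbin]
      rcases lt_or_gt_of_ne hne' with hlt | hlt
      · left
        linarith [sum_Iio_add_le_sum_Iio (hV (f t).1.1) hlt]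
      · right
        linarith [sum_Iio_add_le_sum_Iio (hV (f t).1.1) hlt]

/-- Guarantee of `greedyPack` for the sliceable 2-D bin
packing problem: the wide items `W̃` (width in `(1/2,1]`) can be sliced by
horizontal cuts, the tall items `H̃` (height in `(1/2,1]`) by vertical cuts,
and all the slices packed into at most
`max(⌈∑ h(W̃)⌉, ⌈∑ w(H̃)⌉, (4/3)·a(W̃ ∪ H̃) + 8/3)` unit square bins. -/
theorem greedyPack_guarantee
    (nW nH : ℕ) (wW hW : Fin nW → ℝ) (wH hH : Fin nH → ℝ)
    (hwW : ∀ i, 1/2 < wW i ∧ wW i ≤ 1) (hhW : ∀ i, 0 < hW i)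
    (hhH : ∀ i, 1/2 < hH i ∧ hH i ≤ 1) (hwH : ∀ i, 0 < wH i) :
    ∃ (mW mH : ℕ) (fW : Fin mW → Fin nW) (fH : Fin mH → Fin nH)
      (sh : Fin mW → ℝ) (sw : Fin mH → ℝ),
      (∀ s, 0 < sh s) ∧ (∀ s, 0 < sw s) ∧
      (∀ j, ∑ s ∈ Finset.univ.filter (fun s => fW s = j), sh s = hW j) ∧
      (∀ j, ∑ s ∈ Finset.univ.filter (fun s => fH s = j), sw s = wH j) ∧
      ∃ N : ℕ,
        Nonempty (BinPacking (Sum.elim (fun s => wW (fW s)) sw)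
          (Sum.elim sh (fun s => hH (fH s))) N) ∧
        (N : ℝ) ≤ max (max ((⌈∑ i, hW i⌉ : ℤ) : ℝ) ((⌈∑ i, wH i⌉ : ℤ) : ℝ))
          (4/3 * ((∑ i, wW i * hW i) + (∑ i, wH i * hH i)) + 8/3) := by
  have Hu : IsResidual wW hW 1 := ⟨fun i => (hhW i).le, fun i => (hwW i).1.le, by norm_num, le_rfl,
    fun i _ => (hwW i).2⟩
  have Hv : IsResidual hH wH 1 := ⟨fun i => (hwH i).le, fun i => (hhH i).1.le, by norm_num, le_rfl,
    fun i _ => (hhH i).2⟩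
  obtain ⟨N, hD, hN⟩ : ∃ N : ℕ, Distributes wW hH hW wH N ∧
      (N : ℝ) ≤ max (max ((⌈∑ i, hW i⌉ : ℤ) : ℝ) ((⌈∑ i, wH i⌉ : ℤ) : ℝ))
        (4/3 * ((∑ i, wW i * hW i) + (∑ i, wH i * hH i)) + 8/3) := by
    obtain ⟨T, hT⟩ := exists_nat_gt (∑ i, hW i + ∑ i, wH i)
    have hcomm : ∑ i, wH i * hH i = ∑ i, hH i * wH i :=
      Finset.sum_congr rfl fun i _ => mul_comm _ _
    rw [hcomm]
    rcases le_total (∑ i, wH i) (∑ i, hW i) with hle | hle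
    · obtain ⟨N, hD, h1 | h1⟩ := exists_distributes_of_sum_le T Hu Hv hle hT
      · exact ⟨N, hD, le_max_of_le_left (le_max_of_le_left h1)⟩
      · exact ⟨N, hD, le_max_of_le_right (by linarith)⟩
    · obtain ⟨N, hD, h1 | h1⟩ := exists_distributes_of_sum_le T Hv Hu hle (by linarith)
      · exact ⟨N, hD.swap, le_max_of_le_left (le_max_of_le_right h1)⟩
      · exact ⟨N, hD.swap, le_max_of_le_right (by linarith)⟩
  obtain ⟨U, V, x₀, y₀, hU, hV, hfit⟩ := hD
  let e : Fin (Fintype.card (Slice U)) ≃ Slice U := (Fintype.equivFin _).symm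
  let f : Fin (Fintype.card (Slice V)) ≃ Slice V := (Fintype.equivFin _).symm
  exact ⟨_, _, fun s => (e s).1.2, fun s => (f s).1.2, fun s => U (e s).1.1 (e s).1.2,
    fun s => V (f s).1.1 (f s).1.2, fun s => (e s).2, fun s => (f s).2,
    fun j => (sum_slices_eq (fun k => (hfit k).1) e j).trans (hU j),
    fun j => (sum_slices_eq (fun k => (hfit k).2.1) f j).trans (hV j), N,
    nonempty_binPacking_of_fitsBin (fun i => (hwW i).2) (fun j => (hhH j).2) hfit e f, hN⟩
end

section
/- Let B be an axis-aligned rectangle and let I be a finite set of n axis-aligned rectangles contained in B with pairwise disjoint interiors. Then there exists a set R of at most 3n + 1 axis-aligned rectangles such that all the rectangles of I ∪ R have pairwise disjoint interiors and the union of the rectangles of I ∪ R equals B. -/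
/-- An axis-aligned closed rectangle given by the coordinates of its left,
bottom, right and top edges. -/
structure Rect where
  x1 : ℝ
  y1 : ℝ
  x2 : ℝ
  y2 : ℝ

/-- The closed rectangle as a set of points. -/
def Rect.toSet (r : Rect) : Set (ℝ × ℝ) := Set.Icc r.x1 r.x2 ×ˢ Set.Icc r.y1 r.y2

/-- The open interior of a rectangle. -/
def Rect.interior (r : Rect) : Set (ℝ × ℝ) := Set.Ioo r.x1 r.x2 ×ˢ Set.Ioo r.y1 r.y2

namespace Rect

/-- A rectangle with nonempty interior. -/
def Proper (r : Rect) : Prop := r.x1 < r.x2 ∧ r.y1 < r.y2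

/-- One of the four sides of `r` separates it from `s`. -/
def Separated (r s : Rect) : Prop :=
  r.x2 ≤ s.x1 ∨ s.x2 ≤ r.x1 ∨ r.y2 ≤ s.y1 ∨ s.y2 ≤ r.y1

/-- The half-open rectangle, containing its left and bottom edges only. -/
def halfOpen (r : Rect) : Set (ℝ × ℝ) := Set.Ico r.x1 r.x2 ×ˢ Set.Ico r.y1 r.y2

theorem Separated.interior_inter_eq_empty {r s : Rect} (h : r.Separated s) :
    r.interior ∩ s.interior = ∅ := by
  ext ⟨x, y⟩
  simp only [interior, Separated, Set.mem_inter_iff, Set.mem_prod, Set.mem_Ioo,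
    Set.mem_empty_iff_false, iff_false] at *
  grind

theorem interior_eq_empty_of_not_proper {r : Rect} (h : ¬ r.Proper) : r.interior = ∅ := by
  ext ⟨x, y⟩
  simp only [interior, Proper, Set.mem_prod, Set.mem_Ioo, Set.mem_empty_iff_false,
    iff_false] at *
  grind

theorem Proper.separated_of_interior_inter_eq_empty {r s : Rect} (hr : r.Proper) (hs : s.Proper)
    (h : r.interior ∩ s.interior = ∅) : r.Separated s := by
  by_contra hsep
  simp only [Separated, Proper, not_or, not_le] at hsep hr hs
  obtain ⟨x, hx, hx'⟩ : ∃ x, max r.x1 s.x1 < x ∧ x < min r.x2 s.x2 := exists_between (by grind)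
  obtain ⟨y, hy, hy'⟩ : ∃ y, max r.y1 s.y1 < y ∧ y < min r.y2 s.y2 := exists_between (by grind)
  have : (x, y) ∈ r.interior ∩ s.interior := by
    simp only [interior, Set.mem_inter_iff, Set.mem_prod, Set.mem_Ioo]
    grind
  simp [h] at this

theorem le_of_toSet_subset {r s : Rect} (hr : r.x1 ≤ r.x2 ∧ r.y1 ≤ r.y2)
    (h : r.toSet ⊆ s.toSet) :
    s.x1 ≤ r.x1 ∧ r.x2 ≤ s.x2 ∧ s.y1 ≤ r.y1 ∧ r.y2 ≤ s.y2 := by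
  have h₁ : (r.x1, r.y1) ∈ s.toSet := h (by simp [toSet, hr])
  have h₂ : (r.x2, r.y2) ∈ s.toSet := h (by simp [toSet, hr])
  simp only [toSet, Set.mem_prod, Set.mem_Icc] at h₁ h₂
  grind

theorem toSet_mono {r s : Rect}
    (h : s.x1 ≤ r.x1 ∧ r.x2 ≤ s.x2 ∧ s.y1 ≤ r.y1 ∧ r.y2 ≤ s.y2) : r.toSet ⊆ s.toSet :=
  Set.prod_mono (Set.Icc_subset_Icc h.1 h.2.1) (Set.Icc_subset_Icc h.2.2.1 h.2.2.2)

theorem halfOpen_subset_toSet (r : Rect) : r.halfOpen ⊆ r.toSet :=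
  Set.prod_mono Set.Ico_subset_Icc_self Set.Ico_subset_Icc_self

theorem Proper.closure_halfOpen {r : Rect} (h : r.Proper) : closure r.halfOpen = r.toSet := by
  rw [halfOpen, closure_prod_eq, closure_Ico h.1.ne, closure_Ico h.2.ne, toSet]

theorem isClosed_toSet (r : Rect) : IsClosed r.toSet := isClosed_Icc.prod isClosed_Icc

/-- `r` is a cell of the decomposition of the space of `B` not covered by the rectangles `I`
that is obtained by extending all the horizontal edges of the rectangles `I`. -/
structure IsCell {ι : Type*} (B : Rect) (I : ι → Rect) (r : Rect) : Prop where
  proper : r.Proper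
  le_x1 : B.x1 ≤ r.x1
  x2_le : r.x2 ≤ B.x2
  le_y1 : B.y1 ≤ r.y1
  y2_le : r.y2 ≤ B.y2
  separated : ∀ i, r.Separated (I i)
  left : r.x1 = B.x1 ∨ ∃ j, r.x1 = (I j).x2 ∧ (I j).y1 ≤ r.y1 ∧ r.y2 ≤ (I j).y2
  right : r.x2 = B.x2 ∨ ∃ j, r.x2 = (I j).x1 ∧ (I j).y1 ≤ r.y1 ∧ r.y2 ≤ (I j).y2
  bottom : r.y1 = B.y1 ∨
    (∃ j, r.y1 = (I j).y1 ∧ r.y2 ≤ (I j).y2 ∧ (r.x1 = (I j).x2 ∨ r.x2 = (I j).x1)) ∨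
    ∃ i, r.y1 = (I i).y2 ∧ (I i).x1 < r.x2 ∧ r.x1 < (I i).x2
  top : r.y2 = B.y2 ∨
    (∃ j, r.y2 = (I j).y2 ∧ (I j).y1 ≤ r.y1 ∧ (r.x1 = (I j).x2 ∨ r.x2 = (I j).x1)) ∨
    ∃ i, r.y2 = (I i).y1 ∧ (I i).x1 < r.x2 ∧ r.x1 < (I i).x2

section

variable {ι : Type*} {B : Rect} {I : ι → Rect}

theorem IsCell.x1_le {r s : Rect} (hr : B.IsCell I r) (hs : B.IsCell I s)
    (hI : ∀ i, (I i).Proper) {x y : ℝ} (hxr : (x, y) ∈ r.halfOpen) (hxs : (x, y) ∈ s.halfOpen) :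
    r.x1 ≤ s.x1 := by
  simp only [halfOpen, Set.mem_prod, Set.mem_Ico] at hxr hxs
  rcases hr.left with h | ⟨j, h⟩
  · exact h ▸ hs.le_x1
  · have := hs.separated j
    have := hI j
    simp only [Separated, Proper] at *
    grind

theorem IsCell.le_x2 {r s : Rect} (hr : B.IsCell I r) (hs : B.IsCell I s)
    (hI : ∀ i, (I i).Proper) {x y : ℝ} (hxr : (x, y) ∈ r.halfOpen) (hxs : (x, y) ∈ s.halfOpen) :
    s.x2 ≤ r.x2 := by
  simp only [halfOpen, Set.mem_prod, Set.mem_Ico] at hxr hxs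
  rcases hr.right with h | ⟨j, h⟩
  · exact h ▸ hs.x2_le
  · have := hs.separated j
    have := hI j
    simp only [Separated, Proper] at *
    grind

/-- A rectangle adjacent to the side of a cell at some height is adjacent to that side along
the whole height of the cell. -/
theorem IsCell.spans_of_adjacent {s : Rect} (hs : B.IsCell I s) (hI : ∀ i, (I i).Proper)
    (hB : ∀ i, B.x1 ≤ (I i).x1 ∧ (I i).x2 ≤ B.x2)
    (hsep : ∀ i j, i ≠ j → (I i).Separated (I j)) {y : ℝ} (hy : s.y1 ≤ y ∧ y < s.y2) {j : ι}
    (hj : (I j).y1 ≤ y ∧ y < (I j).y2) (hadj : s.x1 = (I j).x2 ∨ s.x2 = (I j).x1) :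
    (I j).y1 ≤ s.y1 ∧ s.y2 ≤ (I j).y2 := by
  have hIj := hI j
  have hBj := hB j
  simp only [Proper] at hIj
  rcases hadj with hadj | hadj
  · rcases hs.left with h | ⟨k, h⟩
    · grind
    · have hIk := hI k
      have := hsep j k
      simp only [Separated, Proper] at *
      grind
  · rcases hs.right with h | ⟨k, h⟩
    · grind
    · have hIk := hI k
      have := hsep j k
      simp only [Separated, Proper] at *
      grind

theorem IsCell.eq_of_mem {r s : Rect} (hr : B.IsCell I r) (hs : B.IsCell I s)
    (hI : ∀ i, (I i).Proper) (hB : ∀ i, B.x1 ≤ (I i).x1 ∧ (I i).x2 ≤ B.x2)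
    (hsep : ∀ i j, i ≠ j → (I i).Separated (I j))
    {x y : ℝ} (hxr : (x, y) ∈ r.halfOpen) (hxs : (x, y) ∈ s.halfOpen) : r = s := by
  have hx1 : r.x1 = s.x1 := le_antisymm (hr.x1_le hs hI hxr hxs) (hs.x1_le hr hI hxs hxr)
  have hx2 : r.x2 = s.x2 := le_antisymm (hs.le_x2 hr hI hxs hxr) (hr.le_x2 hs hI hxr hxs)
  have key : ∀ {r s : Rect}, B.IsCell I r → B.IsCell I s → (x, y) ∈ r.halfOpen →
      (x, y) ∈ s.halfOpen → r.x1 = s.x1 → r.x2 = s.x2 → r.y1 ≤ s.y1 ∧ s.y2 ≤ r.y2 := by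
    intro r s hr hs hxr hxs hx1 hx2
    simp only [halfOpen, Set.mem_prod, Set.mem_Ico] at hxr hxs
    constructor
    · rcases hr.bottom with h | ⟨j, h⟩ | ⟨i, h⟩
      · exact h ▸ hs.le_y1
      · have := hs.spans_of_adjacent hI hB hsep hxs.2 (j := j) (by grind) (by grind)
        grind
      · have := hs.separated i
        have := hI i
        simp only [Separated, Proper] at *
        grind
    · rcases hr.top with h | ⟨j, h⟩ | ⟨i, h⟩
      · exact h ▸ hs.y2_le
      · have := hs.spans_of_adjacent hI hB hsep hxs.2 (j := j) (by grind) (by grind)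
        grind
      · have := hs.separated i
        have := hI i
        simp only [Separated, Proper] at *
        grind
  have h₁ := key hr hs hxr hxs hx1 hx2
  have h₂ := key hs hr hxs hxr hx1.symm hx2.symm
  cases r
  cases s
  simp only [mk.injEq] at *
  grind

theorem IsCell.separated_of_ne {r s : Rect} (hr : B.IsCell I r) (hs : B.IsCell I s)
    (hI : ∀ i, (I i).Proper) (hB : ∀ i, B.x1 ≤ (I i).x1 ∧ (I i).x2 ≤ B.x2)
    (hsep : ∀ i j, i ≠ j → (I i).Separated (I j)) (hne : r ≠ s) : r.Separated s := by
  by_contra h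
  refine hne (hr.eq_of_mem hs hI hB hsep (x := max r.x1 s.x1) (y := max r.y1 s.y1) ?_ ?_)
  all_goals
    have := hr.proper
    have := hs.proper
    simp only [halfOpen, Set.mem_prod, Set.mem_Ico, Separated, Proper] at *
    grind

/-- The ways in which the lower edge of a cell can arise: from the bottom of `B`, on the right
or on the left of the lower edge of a rectangle, or above the upper edge of a rectangle. -/
def CreatedBy (B : Rect) (I : ι → Rect) (r : Rect) : Option (ι ⊕ ι ⊕ ι) → Prop
  | none => r.x1 = B.x1 ∧ r.y1 = B.y1
  | some (.inl j) => r.x1 = (I j).x2 ∧ r.y1 = (I j).y1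
  | some (.inr (.inl j)) => r.x2 = (I j).x1 ∧ r.y1 = (I j).y1
  | some (.inr (.inr i)) => r.x1 ≤ (I i).x1 ∧ (I i).x1 < r.x2 ∧ r.y1 = (I i).y2

theorem IsCell.exists_createdBy {r : Rect} (hr : B.IsCell I r)
    (hI : ∀ i, (I i).Proper)
    (hB : ∀ i, B.x1 ≤ (I i).x1 ∧ B.y1 ≤ (I i).y1)
    (hsep : ∀ i j, i ≠ j → (I i).Separated (I j)) : ∃ k, B.CreatedBy I r k := by
  have hp := hr.proper
  rcases hr.bottom with h | ⟨j, h, -, h' | h'⟩ | ⟨i, h⟩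
  · rcases hr.left with h' | ⟨j, hj⟩
    · exact ⟨none, h', h⟩
    · exact ⟨some (.inl j), hj.1, by have := hB j; grind⟩
  · exact ⟨some (.inl j), h', h⟩
  · exact ⟨some (.inr (.inl j)), h', h⟩
  · rcases hr.left with h' | ⟨j, hj⟩
    · exact ⟨some (.inr (.inr i)), h' ▸ (hB i).1, h.2.1, h.1⟩
    · by_cases hy : r.y1 = (I j).y1
      · exact ⟨some (.inl j), hj.1, hy⟩
      · refine ⟨some (.inr (.inr i)), ?_, h.2.1, h.1⟩
        have := hsep i j
        have := hI i
        have := lt_of_le_of_ne hj.2.1 (Ne.symm hy)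
        simp only [Separated, Proper] at *
        grind

theorem IsCell.eq_of_createdBy {r s : Rect} (hr : B.IsCell I r) (hs : B.IsCell I s)
    (hI : ∀ i, (I i).Proper) (hB : ∀ i, B.x1 ≤ (I i).x1 ∧ (I i).x2 ≤ B.x2)
    (hsep : ∀ i j, i ≠ j → (I i).Separated (I j)) {k : Option (ι ⊕ ι ⊕ ι)}
    (hrk : B.CreatedBy I r k) (hsk : B.CreatedBy I s k) : r = s := by
  by_contra hne
  have h := hr.separated_of_ne hs hI hB hsep hne
  have := hr.proper
  have := hs.proper
  rcases k with _ | j | j | i <;> simp only [CreatedBy, Separated, Proper] at * <;> grind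

theorem exists_max_of_finite {κ α : Type*} [Finite κ] [LinearOrder α] (v : α) (f : κ → α)
    (P : κ → Prop) :
    ∃ a, v ≤ a ∧ (∀ i, P i → f i ≤ a) ∧ (a = v ∨ ∃ i, P i ∧ a = f i) := by
  obtain ⟨a, ha, hmax⟩ := Set.exists_max_image (insert v (f '' {i | P i})) id
    ((Set.toFinite _).insert v) (Set.insert_nonempty _ _)
  refine ⟨a, hmax v (Set.mem_insert _ _), fun i hi => hmax _ (.inr ⟨i, hi, rfl⟩), ?_⟩
  rcases ha with ha | ⟨i, hi, rfl⟩
  · exact .inl ha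
  · exact .inr ⟨i, hi, rfl⟩

theorem exists_min_of_finite {κ α : Type*} [Finite κ] [LinearOrder α] (v : α) (f : κ → α)
    (P : κ → Prop) :
    ∃ a, a ≤ v ∧ (∀ i, P i → a ≤ f i) ∧ (a = v ∨ ∃ i, P i ∧ a = f i) :=
  exists_max_of_finite (α := αᵒᵈ) v f P

theorem exists_isCell_of_mem [Finite ι] (hI : ∀ i, (I i).Proper) {x y : ℝ}
    (hB : (x, y) ∈ B.halfOpen) (hfree : ∀ i, (x, y) ∉ (I i).halfOpen) :
    ∃ r, B.IsCell I r ∧ (x, y) ∈ r.halfOpen := by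
  simp only [halfOpen, Set.mem_prod, Set.mem_Ico] at hB hfree
  obtain ⟨a, haB, ha, ha'⟩ := exists_max_of_finite B.x1 (fun i => (I i).x2)
    (fun i => ((I i).y1 ≤ y ∧ y < (I i).y2) ∧ (I i).x2 ≤ x)
  obtain ⟨b, hbB, hb, hb'⟩ := exists_min_of_finite B.x2 (fun i => (I i).x1)
    (fun i => ((I i).y1 ≤ y ∧ y < (I i).y2) ∧ x < (I i).x1)
  obtain ⟨c, hcB, hc, hc'⟩ := exists_max_of_finite B.y1
    (Sum.elim (fun j => (I j).y1) (fun i => (I i).y2))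
    (Sum.elim (fun j => ((I j).y1 ≤ y ∧ y < (I j).y2) ∧ (a = (I j).x2 ∨ b = (I j).x1))
      (fun i => (I i).y2 ≤ y ∧ (I i).x1 < b ∧ a < (I i).x2))
  obtain ⟨d, hdB, hd, hd'⟩ := exists_min_of_finite B.y2
    (Sum.elim (fun j => (I j).y2) (fun i => (I i).y1))
    (Sum.elim (fun j => ((I j).y1 ≤ y ∧ y < (I j).y2) ∧ (a = (I j).x2 ∨ b = (I j).x1))
      (fun i => y < (I i).y1 ∧ (I i).x1 < b ∧ a < (I i).x2))
  simp only [Sum.forall, Sum.exists, Sum.elim_inl, Sum.elim_inr] at hc hc' hd hd'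
  have hax : a ≤ x := by grind
  have hxb : x < b := by grind
  have hcy : c ≤ y := by grind
  have hyd : y < d := by grind
  refine ⟨⟨a, c, b, d⟩, ?_, ⟨hax, hxb⟩, hcy, hyd⟩
  refine ⟨⟨hax.trans_lt hxb, hcy.trans_lt hyd⟩, haB, hbB, hcB, hdB, fun i => ?_, ?_, ?_, ?_, ?_⟩
  · have := hI i
    have := hfree i
    have := ha i
    have := hb i
    have := hc.2 i
    have := hd.2 i
    simp only [Separated, Proper] at *
    grind
  all_goals dsimp only
  · refine ha'.imp_right fun ⟨j, hj, h⟩ => ⟨j, h, hc.1 j ⟨hj.1, .inl h⟩, hd.1 j ⟨hj.1, .inl h⟩⟩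
  · refine hb'.imp_right fun ⟨j, hj, h⟩ => ⟨j, h, hc.1 j ⟨hj.1, .inr h⟩, hd.1 j ⟨hj.1, .inr h⟩⟩
  · exact hc'.imp_right <| Or.imp (fun ⟨j, hj, h⟩ => ⟨j, h, hd.1 j hj, hj.2⟩)
      fun ⟨i, hi, h⟩ => ⟨i, h, hi.2⟩
  · exact hd'.imp_right <| Or.imp (fun ⟨j, hj, h⟩ => ⟨j, h, hc.1 j hj, hj.2⟩)
      fun ⟨i, hi, h⟩ => ⟨i, h, hi.2⟩

theorem finite_and_card_isCell_le [Finite ι] (hI : ∀ i, (I i).Proper)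
    (hB : ∀ i, B.x1 ≤ (I i).x1 ∧ (I i).x2 ≤ B.x2 ∧ B.y1 ≤ (I i).y1 ∧ (I i).y2 ≤ B.y2)
    (hsep : ∀ i j, i ≠ j → (I i).Separated (I j)) :
    Finite {r // B.IsCell I r} ∧ Nat.card {r // B.IsCell I r} ≤ 3 * Nat.card ι + 1 := by
  choose f hf using fun r : {r // B.IsCell I r} =>
    r.2.exists_createdBy hI (fun i => ⟨(hB i).1, (hB i).2.2.1⟩) hsep
  have hinj : Function.Injective f := fun r s hrs => Subtype.ext <|
    r.2.eq_of_createdBy s.2 hI (fun i => ⟨(hB i).1, (hB i).2.1⟩) hsep (hf r) (hrs ▸ hf s)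
  refine ⟨Finite.of_injective f hinj, (Nat.card_le_card_of_injective f hinj).trans_eq ?_⟩
  rw [Finite.card_option, Nat.card_sum, Nat.card_sum]
  ring

end

end Rect

/-- Given `n` rectangles with pairwise disjoint interiors
contained in a rectangle `B`, the empty space of `B` around them can be
decomposed into at most `3n + 1` rectangles: there exist at most `3n + 1`
further rectangles so that all rectangles together have pairwise disjoint
interiors and their union is `B`. -/
theorem empty_space_decomposition
    (B : Rect) (hB : B.x1 ≤ B.x2 ∧ B.y1 ≤ B.y2)
    (n : ℕ) (I : Fin n → Rect)
    (hI : ∀ i, (I i).x1 ≤ (I i).x2 ∧ (I i).y1 ≤ (I i).y2)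
    (hsub : ∀ i, (I i).toSet ⊆ B.toSet)
    (hdisj : ∀ i j, i ≠ j → (I i).interior ∩ (I j).interior = ∅) :
    ∃ (m : ℕ) (R : Fin m → Rect), m ≤ 3*n + 1 ∧
      (∀ p q : Fin n ⊕ Fin m, p ≠ q →
        (Sum.elim I R p).interior ∩ (Sum.elim I R q).interior = ∅) ∧
      (⋃ p : Fin n ⊕ Fin m, (Sum.elim I R p).toSet) = B.toSet := by
  have hle i := Rect.le_of_toSet_subset (hI i) (hsub i)
  by_cases hBp : B.Proper
  · let J : {i // (I i).Proper} → Rect := fun i => I i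
    have hJ : ∀ i, (J i).Proper := fun i => i.2
    have hJB : ∀ i, B.x1 ≤ (J i).x1 ∧ (J i).x2 ≤ B.x2 ∧ B.y1 ≤ (J i).y1 ∧ (J i).y2 ≤ B.y2 :=
      fun i => hle i
    have hJx : ∀ i, B.x1 ≤ (J i).x1 ∧ (J i).x2 ≤ B.x2 := fun i => ⟨(hJB i).1, (hJB i).2.1⟩
    have hJsep : ∀ i j, i ≠ j → (J i).Separated (J j) := fun i j hij =>
      (hJ i).separated_of_interior_inter_eq_empty (hJ j) (hdisj i j (Subtype.coe_ne_coe.2 hij))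
    obtain ⟨hfin, hcard⟩ := Rect.finite_and_card_isCell_le hJ hJB hJsep
    have hcardJ : Nat.card {i // (I i).Proper} ≤ n := by
      simpa using Finite.card_subtype_le fun i => (I i).Proper
    let e := (Finite.equivFin {r // B.IsCell J r}).symm
    have hIR : ∀ i k, (I i).interior ∩ (e k).1.interior = ∅ := by
      intro i k
      by_cases hi : (I i).Proper
      · rw [Set.inter_comm]
        exact ((e k).2.separated ⟨i, hi⟩).interior_inter_eq_empty
      · rw [Rect.interior_eq_empty_of_not_proper hi, Set.empty_inter]
    refine ⟨_, fun k => (e k).1, by omega, ?_, ?_⟩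
    · rintro (i | k) (j | l) hne
      · exact hdisj i j (by simpa using hne)
      · exact hIR i l
      · exact Set.inter_comm _ _ ▸ hIR j k
      · refine ((e k).2.separated_of_ne (e l).2 hJ hJx hJsep fun h => hne ?_).interior_inter_eq_empty
        rw [e.injective (Subtype.ext h)]
    · apply Set.Subset.antisymm
      · refine Set.iUnion_subset ?_
        rintro (i | k)
        · exact hsub i
        · have h := (e k).2
          exact Rect.toSet_mono ⟨h.le_x1, h.x2_le, h.le_y1, h.y2_le⟩
      · rw [← hBp.closure_halfOpen]
        refine closure_minimal ?_ (isClosed_iUnion_of_finite fun p => Rect.isClosed_toSet _)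
        rintro ⟨x, y⟩ hxy
        by_cases hfree : ∀ i, (x, y) ∉ (J i).halfOpen
        · obtain ⟨r, hr, hxr⟩ := Rect.exists_isCell_of_mem hJ hxy hfree
          refine Set.mem_iUnion.2 ⟨.inr (e.symm ⟨r, hr⟩), ?_⟩
          simpa using r.halfOpen_subset_toSet hxr
        · push Not at hfree
          obtain ⟨i, hi⟩ := hfree
          exact Set.mem_iUnion.2 ⟨.inl i, (J i).halfOpen_subset_toSet hi⟩
  · have hIp : ∀ i, ¬ (I i).Proper := fun i hi => hBp <| by
      have := hle i
      simp only [Rect.Proper] at *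
      grind
    refine ⟨1, fun _ => B, by omega, ?_, ?_⟩
    · rintro (i | k) q hne
      · simp [Rect.interior_eq_empty_of_not_proper (hIp i)]
      · simp [Rect.interior_eq_empty_of_not_proper hBp]
    · apply Set.Subset.antisymm
      · refine Set.iUnion_subset ?_
        rintro (i | k)
        · exact hsub i
        · exact subset_rfl
      · exact Set.subset_iUnion (fun p => (Sum.elim I (fun _ : Fin 1 => B) p).toSet) (.inr 0)
end

section
/- Let k be a positive integer and ε ∈ (0,1). Let J be a finite set of items, each of which either has width (1+ε)/2 and height (1−ε)/(2k), or has width (1−ε)/(2k) and height (1+ε)/2. If J admits a guillotine-separable packing into a single unit square bin, then a(J) ≤ 3/4 + ε/2 − ε²/4. -/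
/-- `Guillotine p S R` : the rectangles `p i` for `i ∈ S`, packed inside the
region `R`, are guillotine-separable: either `S` has at most one element, or
there is a vertical or horizontal end-to-end cut of `R` meeting the interior
of no rectangle of `S` such that the induced packings in the two resulting
subregions are recursively guillotine-separable. -/
inductive Guillotine {ι : Type} (p : ι → Rect) : Finset ι → Rect → Prop
  | leaf (S : Finset ι) (R : Rect) (hcard : S.card ≤ 1) : Guillotine p S R
  | vert (S : Finset ι) (R : Rect) (c : ℝ) (h1 : R.x1 ≤ c) (h2 : c ≤ R.x2)
      (hsep : ∀ i ∈ S, (p i).x2 ≤ c ∨ c ≤ (p i).x1)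
      (hleft : Guillotine p (S.filter fun i => (p i).x2 ≤ c) ⟨R.x1, R.y1, c, R.y2⟩)
      (hright : Guillotine p (S.filter fun i => ¬ (p i).x2 ≤ c) ⟨c, R.y1, R.x2, R.y2⟩) :
      Guillotine p S R
  | horiz (S : Finset ι) (R : Rect) (c : ℝ) (h1 : R.y1 ≤ c) (h2 : c ≤ R.y2)
      (hsep : ∀ i ∈ S, (p i).y2 ≤ c ∨ c ≤ (p i).y1)
      (hbot : Guillotine p (S.filter fun i => (p i).y2 ≤ c) ⟨R.x1, R.y1, R.x2, c⟩)
      (htop : Guillotine p (S.filter fun i => ¬ (p i).y2 ≤ c) ⟨R.x1, c, R.x2, R.y2⟩) :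
      Guillotine p S R

/-- The placed rectangle of item `i` in the packing `P`. -/
noncomputable def BinPacking.rect {ι : Type} [Fintype ι] {w h : ι → ℝ} {N : ℕ}
    (P : BinPacking w h N) (i : ι) : Rect :=
  ⟨P.x i, P.y i, P.x i + w i, P.y i + h i⟩

/-- A bin packing is guillotinable if the packing inside every bin is
guillotine-separable. -/
def BinPacking.Guillotinable {ι : Type} [Fintype ι] {w h : ι → ℝ} {N : ℕ}
    (P : BinPacking w h N) : Prop :=
  ∀ b : Fin N, Guillotine P.rect (Finset.univ.filter fun i => P.bin i = b) ⟨0, 0, 1, 1⟩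

/-- The minimum number of unit square bins in a guillotinable packing. -/
noncomputable def optg {ι : Type} [Fintype ι] (w h : ι → ℝ) : ℕ :=
  sInf {N | ∃ P : BinPacking w h N, P.Guillotinable}

/-- Necessary conditions on the numbers `a` of `L × s` items and `b` of `s × L` items
in a guillotine-separable packing into a region of width `W` and height `H`. -/
structure ItemCountBound (L s : ℝ) (a b : ℕ) (W H : ℝ) : Prop where
  width_nonneg : 0 ≤ W
  height_nonneg : 0 ≤ H
  horiz_le : a * s ≤ H
  vert_le : b * s ≤ W
  le_width : a ≠ 0 → L ≤ W
  le_height : b ≠ 0 → L ≤ H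
  mixed_le : a ≠ 0 → b ≠ 0 → (a + b) * s ≤ W + H - L

namespace ItemCountBound

variable {L s W H : ℝ} {a b : ℕ}

theorem swap (h : ItemCountBound L s a b W H) : ItemCountBound L s b a H W where
  width_nonneg := h.height_nonneg
  height_nonneg := h.width_nonneg
  horiz_le := h.vert_le
  vert_le := h.horiz_le
  le_width := h.le_height
  le_height := h.le_width
  mixed_le hb ha := by linarith [h.mixed_le ha hb]

/-- Adding a strip of width `W'` that contains no `L × s` item. -/
theorem add_strip {W' : ℝ} {b' : ℕ} (h : ItemCountBound L s a b W H)
    (h' : ItemCountBound L s 0 b' W' H) : ItemCountBound L s a (b + b') (W + W') H where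
  width_nonneg := add_nonneg h.width_nonneg h'.width_nonneg
  height_nonneg := h.height_nonneg
  horiz_le := h.horiz_le
  vert_le := by
    push_cast
    linarith [h.vert_le, h'.vert_le]
  le_width ha := by linarith [h.le_width ha, h'.width_nonneg]
  le_height hb := by
    by_cases hb0 : b = 0
    · exact h'.le_height (by omega)
    · exact h.le_height hb0
  mixed_le ha _ := by
    push_cast
    by_cases hb0 : b = 0
    · subst hb0
      push_cast
      linarith [h.le_width ha, h.horiz_le, h'.vert_le]
    · linarith [h.mixed_le ha hb0, h'.vert_le]

theorem add_width {W₁ W₂ : ℝ} {a₁ a₂ b₁ b₂ : ℕ} (hL : 1 / 2 < L) (hW : W₁ + W₂ ≤ 1)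
    (h₁ : ItemCountBound L s a₁ b₁ W₁ H) (h₂ : ItemCountBound L s a₂ b₂ W₂ H) :
    ItemCountBound L s (a₁ + a₂) (b₁ + b₂) (W₁ + W₂) H := by
  by_cases ha₂ : a₂ = 0
  · subst ha₂
    exact h₁.add_strip h₂
  · have ha₁ : a₁ = 0 := by
      by_contra ha₁
      linarith [h₁.le_width ha₁, h₂.le_width ha₂]
    subst ha₁
    simpa only [zero_add, add_comm b₂, add_comm W₂] using h₂.add_strip h₁

theorem add_height {H₁ H₂ : ℝ} {a₁ a₂ b₁ b₂ : ℕ} (hL : 1 / 2 < L) (hH : H₁ + H₂ ≤ 1)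
    (h₁ : ItemCountBound L s a₁ b₁ W H₁) (h₂ : ItemCountBound L s a₂ b₂ W H₂) :
    ItemCountBound L s (a₁ + a₂) (b₁ + b₂) W (H₁ + H₂) :=
  (h₁.swap.add_width hL hH h₂.swap).swap

theorem card_mul_le (hL : L ≤ 1) (h : ItemCountBound L s a b 1 1) :
    (a + b) * s ≤ 2 - L := by
  by_cases ha : a = 0
  · subst ha
    push_cast
    linarith [h.vert_le]
  by_cases hb : b = 0
  · subst hb
    push_cast
    linarith [h.horiz_le]
  linarith [h.mixed_le ha hb]

end ItemCountBound

theorem Finset.card_filter_add_card_filter_not_filter {ι : Type} (S : Finset ι) (P Q : ι → Prop)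
    [DecidablePred P] [DecidablePred Q] :
    ((S.filter Q).filter P).card + ((S.filter fun i => ¬ Q i).filter P).card =
      (S.filter P).card := by
  rw [← Finset.card_filter_add_card_filter_not (s := S.filter P) Q, Finset.filter_comm P Q,
    Finset.filter_comm P fun i => ¬ Q i]

theorem Guillotine.itemCountBound {ι : Type} {p : ι → Rect} {L s : ℝ} (hL : 1 / 2 < L)
    (T : ι → Prop) [DecidablePred T]
    (hT : ∀ i, T i → (p i).x2 = (p i).x1 + L ∧ (p i).y2 = (p i).y1 + s)
    (hnT : ∀ i, ¬ T i → (p i).x2 = (p i).x1 + s ∧ (p i).y2 = (p i).y1 + L)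
    {S : Finset ι} {R : Rect} (hg : Guillotine p S R)
    (hx : R.x1 ≤ R.x2) (hy : R.y1 ≤ R.y2) (hW : R.x2 - R.x1 ≤ 1) (hH : R.y2 - R.y1 ≤ 1)
    (hS : ∀ i ∈ S, R.x1 ≤ (p i).x1 ∧ (p i).x2 ≤ R.x2 ∧ R.y1 ≤ (p i).y1 ∧ (p i).y2 ≤ R.y2) :
    ItemCountBound L s (S.filter T).card (S.filter fun i => ¬ T i).card
      (R.x2 - R.x1) (R.y2 - R.y1) := by
  induction hg with
  | leaf S R hcard =>
    rcases Nat.le_one_iff_eq_zero_or_eq_one.mp hcard with h0 | h1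
    · rw [Finset.card_eq_zero] at h0
      subst h0
      constructor <;> simp <;> linarith
    · obtain ⟨i, rfl⟩ := Finset.card_eq_one.mp h1
      obtain ⟨hx1, hx2, hy1, hy2⟩ := hS i (Finset.mem_singleton_self i)
      by_cases hi : T i
      · obtain ⟨ex, ey⟩ := hT i hi
        constructor <;> simp [Finset.filter_singleton, hi] <;> linarith
      · obtain ⟨ex, ey⟩ := hnT i hi
        constructor <;> simp [Finset.filter_singleton, hi] <;> linarith
  | vert S R c h1 h2 hsep _ _ ihl ihr =>
    have hl := ihl h1 hy (by dsimp only; linarith) hH fun i hi => by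
      obtain ⟨hi, hc⟩ := Finset.mem_filter.mp hi
      exact ⟨(hS i hi).1, hc, (hS i hi).2.2⟩
    have hr := ihr h2 hy (by dsimp only; linarith) hH fun i hi => by
      obtain ⟨hi, hc⟩ := Finset.mem_filter.mp hi
      exact ⟨(hsep i hi).resolve_left hc, (hS i hi).2⟩
    have h := hl.add_width hL (by dsimp only; linarith) hr
    rw [Finset.card_filter_add_card_filter_not_filter,
      Finset.card_filter_add_card_filter_not_filter] at h
    convert h using 1
    ring
  | horiz S R c h1 h2 hsep _ _ ihb iht =>
    have hb := ihb hx h1 hW (by dsimp only; linarith) fun i hi => by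
      obtain ⟨hi, hc⟩ := Finset.mem_filter.mp hi
      exact ⟨(hS i hi).1, (hS i hi).2.1, (hS i hi).2.2.1, hc⟩
    have ht := iht hx h2 hW (by dsimp only; linarith) fun i hi => by
      obtain ⟨hi, hc⟩ := Finset.mem_filter.mp hi
      exact ⟨(hS i hi).1, (hS i hi).2.1, (hsep i hi).resolve_left hc, (hS i hi).2.2.2⟩
    have h := hb.add_height hL (by dsimp only; linarith) ht
    rw [Finset.card_filter_add_card_filter_not_filter,
      Finset.card_filter_add_card_filter_not_filter] at h
    convert h using 1
    ring

/-- If items, each of dimensions `(1+ε)/2 × (1−ε)/(2k)` or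
`(1−ε)/(2k) × (1+ε)/2`, admit a guillotine-separable packing into a single
unit square bin, then their total area is at most `3/4 + ε/2 − ε²/4`. -/
theorem guillotine_bin_area_bound
    (k : ℕ) (hk : 0 < k) (ε : ℝ) (hε0 : 0 < ε) (hε1 : ε < 1)
    (n : ℕ) (w h : Fin n → ℝ)
    (hitem : ∀ i, (w i = (1+ε)/2 ∧ h i = (1-ε)/(2*(k:ℝ))) ∨
      (w i = (1-ε)/(2*(k:ℝ)) ∧ h i = (1+ε)/2))
    (x y : Fin n → ℝ)
    (hin : ∀ i, 0 ≤ x i ∧ x i + w i ≤ 1 ∧ 0 ≤ y i ∧ y i + h i ≤ 1)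
    (hdisj : ∀ i j, i ≠ j →
      (Set.Ioo (x i) (x i + w i) ×ˢ Set.Ioo (y i) (y i + h i)) ∩
        (Set.Ioo (x j) (x j + w j) ×ˢ Set.Ioo (y j) (y j + h j)) = ∅)
    (hguill : Guillotine (fun i => ⟨x i, y i, x i + w i, y i + h i⟩)
      Finset.univ ⟨0, 0, 1, 1⟩) :
    ∑ i, w i * h i ≤ 3/4 + ε/2 - ε^2/4 := by
  classical
  set L : ℝ := (1 + ε) / 2 with hLdef
  set s : ℝ := (1 - ε) / (2 * (k : ℝ))
  have key := hguill.itemCountBound (L := L) (s := s) (by linarith)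
    (fun i => w i = L ∧ h i = s)
    (fun i hi => by simp [hi.1, hi.2])
    (fun i hi => by
      obtain ⟨hw, hh⟩ := (hitem i).resolve_left hi
      simp [hw, hh])
    (by simp) (by simp) (by simp) (by simp)
    (fun i _ => ⟨(hin i).1, (hin i).2.1, (hin i).2.2.1, (hin i).2.2.2⟩)
  simp only [sub_zero] at key
  have hcard := key.card_mul_le (by linarith)
  rw [← Nat.cast_add, Finset.card_filter_add_card_filter_not] at hcard
  have harea : ∑ i, w i * h i = L * ((Finset.univ : Finset (Fin n)).card * s) := by
    have hi : ∀ i ∈ (Finset.univ : Finset (Fin n)), w i * h i = L * s := fun i _ => by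
      rcases hitem i with ⟨hw, hh⟩ | ⟨hw, hh⟩ <;> rw [hw, hh]
      ring
    rw [Finset.sum_congr rfl hi, Finset.sum_const, nsmul_eq_mul]
    ring
  calc ∑ i, w i * h i ≤ L * (2 - L) := by
        rw [harea]
        exact mul_le_mul_of_nonneg_left hcard (by linarith)
    _ = 3/4 + ε/2 - ε^2/4 := by
        rw [hLdef]
        ring
end

section
/- Let m and k be positive integers and ε ∈ (0,1). Let I be the set of 4mk items consisting of 2mk items of width (1+ε)/2 and height (1−ε)/(2k), together with 2mk items of width (1−ε)/(2k) and height (1+ε)/2. Then opt_g(I) ≥ (4/3)·(1−ε)·opt(I). -/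
/-- Two placed rectangles have disjoint interiors if an axis-parallel line separates them. -/
theorem interior_inter_eq_empty_of_separated {x₁ w₁ y₁ h₁ x₂ w₂ y₂ h₂ : ℝ}
    (h : x₁ + w₁ ≤ x₂ ∨ x₂ + w₂ ≤ x₁ ∨ y₁ + h₁ ≤ y₂ ∨ y₂ + h₂ ≤ y₁) :
    (Set.Ioo x₁ (x₁ + w₁) ×ˢ Set.Ioo y₁ (y₁ + h₁)) ∩
      (Set.Ioo x₂ (x₂ + w₂) ×ˢ Set.Ioo y₂ (y₂ + h₂)) = ∅ := by
  refine Set.eq_empty_of_forall_notMem ?_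
  rintro ⟨u, v⟩ ⟨⟨⟨_, _⟩, _, _⟩, ⟨_, _⟩, _, _⟩
  rcases h with h | h | h | h <;> simp only at * <;> linarith

/-- The offset of the `r`-th of `2k` strips of thickness `b`: the first `k` strips are stacked
from `0` upwards, the last `k` strips end at `1`. -/
noncomputable def stripOffset (k : ℕ) (b : ℝ) (r : ℕ) : ℝ :=
  if r < k then r * b else 1 - k * b + (r - k) * b

section Strip

variable {k r s : ℕ} {b : ℝ}

theorem stripOffset_nonneg (hb : 0 ≤ b) (hkb : 2 * (k * b) ≤ 1) : 0 ≤ stripOffset k b r := by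
  unfold stripOffset
  split_ifs with h
  · positivity
  · have : (k : ℝ) ≤ r := by exact_mod_cast not_lt.mp h
    nlinarith [mul_nonneg (sub_nonneg.2 this) hb, mul_nonneg (Nat.cast_nonneg (α := ℝ) k) hb]

theorem stripOffset_add_le_of_lt (hb : 0 ≤ b) (h : r < k) : stripOffset k b r + b ≤ k * b := by
  have : (r : ℝ) + 1 ≤ k := by exact_mod_cast h
  rw [stripOffset, if_pos h]
  nlinarith

theorem le_stripOffset_of_le (hb : 0 ≤ b) (h : k ≤ r) : 1 - k * b ≤ stripOffset k b r := by
  have : (k : ℝ) ≤ r := by exact_mod_cast h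
  rw [stripOffset, if_neg (not_lt.2 h)]
  nlinarith

theorem stripOffset_add_le_one (hb : 0 ≤ b) (hkb : 2 * (k * b) ≤ 1) (h : r < 2 * k) :
    stripOffset k b r + b ≤ 1 := by
  rcases lt_or_ge r k with hr | hr
  · have := stripOffset_add_le_of_lt hb hr
    nlinarith [mul_nonneg (Nat.cast_nonneg (α := ℝ) k) hb]
  · have : (r : ℝ) + 1 ≤ 2 * k := by exact_mod_cast h
    rw [stripOffset, if_neg (not_lt.2 hr)]
    nlinarith

theorem stripOffset_add_le (hb : 0 ≤ b) (hkb : 2 * (k * b) ≤ 1) (h : r < s) :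
    stripOffset k b r + b ≤ stripOffset k b s := by
  have hrs : (r : ℝ) + 1 ≤ s := by exact_mod_cast h
  rcases lt_or_ge r k with hr | hr
  · rcases lt_or_ge s k with hs | hs
    · rw [stripOffset, if_pos hr, stripOffset, if_pos hs]
      nlinarith
    · have := stripOffset_add_le_of_lt hb hr
      have := le_stripOffset_of_le hb hs
      linarith
  · rw [stripOffset, if_neg (not_lt.2 hr), stripOffset, if_neg (not_lt.2 (hr.trans h.le))]
    nlinarith

end Strip

/-- The pinwheel packing: each of `m` bins holds two blocks of `k` wide items and two blocks of
`k` tall items arranged around the center. -/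
noncomputable def pinwheelPacking (m k : ℕ) (hk : 0 < k) (a b : ℝ) (hb : 0 ≤ b)
    (hkb : 2 * (k * b) ≤ 1) (ha : a = 1 - k * b) :
    BinPacking (Sum.elim (fun _ : Fin (2*m*k) => a) (fun _ : Fin (2*m*k) => b))
      (Sum.elim (fun _ : Fin (2*m*k) => b) (fun _ : Fin (2*m*k) => a)) m where
  bin i := ⟨(Sum.elim Fin.val Fin.val i) / (2 * k), by
    rw [Nat.div_lt_iff_lt_mul (by omega), ← mul_assoc, mul_comm m 2]
    rcases i with i | i <;> exact i.2⟩
  x := Sum.elim (fun i => if i.val % (2 * k) < k then 0 else k * b)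
    (fun i => stripOffset k b (i.val % (2 * k)))
  y := Sum.elim (fun i => stripOffset k b (i.val % (2 * k)))
    (fun i => if i.val % (2 * k) < k then k * b else 0)
  x_nonneg := by
    rintro (i | i) <;> simp only [Sum.elim_inl, Sum.elim_inr]
    · split_ifs <;> positivity
    · exact stripOffset_nonneg hb hkb
  y_nonneg := by
    rintro (i | i) <;> simp only [Sum.elim_inl, Sum.elim_inr]
    · exact stripOffset_nonneg hb hkb
    · split_ifs <;> positivity
  x_add_le := by
    have hkb' : 0 ≤ k * b := by positivity
    rintro (i | i) <;> simp only [Sum.elim_inl, Sum.elim_inr]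
    · split_ifs <;> linarith
    · exact stripOffset_add_le_one hb hkb (Nat.mod_lt _ (by omega))
  y_add_le := by
    have hkb' : 0 ≤ k * b := by positivity
    rintro (i | i) <;> simp only [Sum.elim_inl, Sum.elim_inr]
    · exact stripOffset_add_le_one hb hkb (Nat.mod_lt _ (by omega))
    · split_ifs <;> linarith
  disj := by
    have same : ∀ i j : Fin (2*m*k), i ≠ j → i.val / (2*k) = j.val / (2*k) →
        stripOffset k b (i.val % (2*k)) + b ≤ stripOffset k b (j.val % (2*k)) ∨
        stripOffset k b (j.val % (2*k)) + b ≤ stripOffset k b (i.val % (2*k)) := by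
      intro i j hij hbin
      have hne : i.val % (2*k) ≠ j.val % (2*k) := by
        intro h
        apply hij
        rw [Fin.ext_iff, ← Nat.div_add_mod i.val (2*k), ← Nat.div_add_mod j.val (2*k), hbin, h]
      rcases lt_or_gt_of_ne hne with h | h
      · exact Or.inl (stripOffset_add_le hb hkb h)
      · exact Or.inr (stripOffset_add_le hb hkb h)
    have cross : ∀ r s : ℕ,
        ((if r < k then 0 else k * b) + a ≤ stripOffset k b s ∨
          stripOffset k b s + b ≤ (if r < k then 0 else k * b)) ∨
        (stripOffset k b r + b ≤ (if s < k then k * b else 0) ∨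
          (if s < k then k * b else 0) + a ≤ stripOffset k b r) := by
      intro r s
      rcases lt_or_ge r k with hr | hr <;> rcases lt_or_ge s k with hs | hs
      · have := stripOffset_add_le_of_lt hb hr
        simp [hr, hs, this]
      · have := le_stripOffset_of_le hb hs
        simp [hr, ha, this]
      · have := stripOffset_add_le_of_lt hb hs
        simp [hr.not_gt, this]
      · have := le_stripOffset_of_le hb hr
        simp [hs.not_gt, ha, this]
    rintro (i | i) (j | j) hij hbin <;>
      simp only [Sum.elim_inl, Sum.elim_inr, Fin.mk.injEq, ne_eq, Sum.inl.injEq,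
        Sum.inr.injEq] at hij hbin ⊢ <;>
      apply interior_inter_eq_empty_of_separated
    · have := same i j hij hbin
      tauto
    · have := cross (i.val % (2*k)) (j.val % (2*k))
      tauto
    · have := cross (j.val % (2*k)) (i.val % (2*k))
      tauto
    · have := same i j hij hbin
      tauto

/-- Bounds on the numbers `nw` of wide items (width `a`, height `b`) and `nt` of tall items
(width `b`, height `a`) of a guillotine packing in a region of width `W` and height `H`. -/
structure CountBound (a b : ℝ) (nw nt : ℕ) (W H : ℝ) : Prop where
  wide : nw * b ≤ H
  tall : nt * b ≤ W
  width_of_wide : 0 < nw → a ≤ W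
  height_of_tall : 0 < nt → a ≤ H
  both : 0 < nw → 0 < nt → (nw + nt) * b ≤ W + H - 1/2

namespace CountBound

variable {a b W H W₁ W₂ H₁ H₂ : ℝ} {nw nt nw₁ nw₂ nt₁ nt₂ : ℕ}

theorem swap (h : CountBound a b nw nt W H) : CountBound a b nt nw H W where
  wide := h.tall
  tall := h.wide
  width_of_wide := h.height_of_tall
  height_of_tall := h.width_of_wide
  both h₁ h₂ := by linarith [h.both h₂ h₁]

theorem add_of_right_wide_eq_zero (ha : 1/2 < a)
    (h₁ : CountBound a b nw nt₁ W₁ H) (h₂ : CountBound a b 0 nt₂ W₂ H) (hW₂ : 0 ≤ W₂) :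
    CountBound a b nw (nt₁ + nt₂) (W₁ + W₂) H where
  wide := h₁.wide
  tall := by push_cast; linarith [h₁.tall, h₂.tall]
  width_of_wide h := by linarith [h₁.width_of_wide h]
  height_of_tall h := by
    rcases Nat.eq_zero_or_pos nt₁ with h0 | h0
    · exact h₂.height_of_tall (by omega)
    · exact h₁.height_of_tall h0
  both hw _ := by
    have := h₂.tall
    rcases Nat.eq_zero_or_pos nt₁ with rfl | h0
    · have := h₁.wide
      have := h₁.width_of_wide hw
      push_cast
      linarith
    · have := h₁.both hw h0
      push_cast
      linarith

theorem add (ha : 1/2 < a) (hW₁ : 0 ≤ W₁) (hW₂ : 0 ≤ W₂) (hW : W₁ + W₂ ≤ 1)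
    (h₁ : CountBound a b nw₁ nt₁ W₁ H) (h₂ : CountBound a b nw₂ nt₂ W₂ H) :
    CountBound a b (nw₁ + nw₂) (nt₁ + nt₂) (W₁ + W₂) H := by
  rcases Nat.eq_zero_or_pos nw₂ with rfl | hw₂
  · exact add_of_right_wide_eq_zero ha h₁ h₂ hW₂
  rcases Nat.eq_zero_or_pos nw₁ with rfl | hw₁
  · have := add_of_right_wide_eq_zero ha h₂ h₁ hW₁
    rwa [add_comm nt₂, add_comm W₂, ← zero_add nw₂] at this
  · linarith [h₁.width_of_wide hw₁, h₂.width_of_wide hw₂]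

theorem add_mul_le (h : CountBound a b nw nt W H) (hW : W ≤ 1) (hH : H ≤ 1) :
    (nw + nt) * b ≤ 3/2 := by
  have hw := h.wide
  have ht := h.tall
  rcases Nat.eq_zero_or_pos nw with rfl | h0
  · push_cast
    linarith
  rcases Nat.eq_zero_or_pos nt with rfl | h1
  · push_cast
    linarith
  · linarith [h.both h0 h1]

end CountBound

theorem card_filter_split {ι : Type} (S : Finset ι) (T q : ι → Prop) [DecidablePred T]
    [DecidablePred q] : (S.filter T).card =
      ((S.filter q).filter T).card + ((S.filter fun i => ¬ q i).filter T).card := by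
  rw [Finset.filter_comm (s := S) q T, Finset.filter_comm (s := S) (fun i => ¬ q i) T,
    Finset.card_filter_add_card_filter_not]

theorem Guillotine.countBound {ι : Type} {p : ι → Rect} {S : Finset ι} {R : Rect}
    (hG : Guillotine p S R) (T : ι → Prop) [DecidablePred T] {a b : ℝ} (ha : 1/2 < a)
    (hwide : ∀ i, T i → (p i).x2 = (p i).x1 + a ∧ (p i).y2 = (p i).y1 + b)
    (htall : ∀ i, ¬ T i → (p i).x2 = (p i).x1 + b ∧ (p i).y2 = (p i).y1 + a)
    (hx : R.x1 ≤ R.x2) (hy : R.y1 ≤ R.y2) (hx1 : R.x2 - R.x1 ≤ 1) (hy1 : R.y2 - R.y1 ≤ 1)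
    (hin : ∀ i ∈ S, R.x1 ≤ (p i).x1 ∧ (p i).x2 ≤ R.x2 ∧ R.y1 ≤ (p i).y1 ∧ (p i).y2 ≤ R.y2) :
    CountBound a b (S.filter T).card (S.filter fun i => ¬ T i).card
      (R.x2 - R.x1) (R.y2 - R.y1) := by
  induction hG with
  | leaf S R hcard =>
    rcases Nat.le_one_iff_eq_zero_or_eq_one.1 hcard with h0 | h1
    · rw [Finset.card_eq_zero] at h0
      subst h0
      constructor <;> simp <;> assumption
    · obtain ⟨i, rfl⟩ := Finset.card_eq_one.1 h1
      obtain ⟨h₁, h₂, h₃, h₄⟩ := hin i (Finset.mem_singleton_self i)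
      by_cases hi : T i
      · obtain ⟨h₅, h₆⟩ := hwide i hi
        constructor <;> simp [Finset.filter_singleton, hi] <;> linarith
      · obtain ⟨h₅, h₆⟩ := htall i hi
        constructor <;> simp [Finset.filter_singleton, hi] <;> linarith
  | vert S R c h1 h2 hsep _ _ ihl ihr =>
    have hl := ihl h1 hy (by simp only; linarith) hy1 fun i hi => by
      rw [Finset.mem_filter] at hi
      obtain ⟨h₁, -, h₃⟩ := hin i hi.1
      exact ⟨h₁, hi.2, h₃⟩
    have hr := ihr h2 hy (by simp only; linarith) hy1 fun i hi => by
      rw [Finset.mem_filter] at hi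
      obtain ⟨-, h₂, h₃⟩ := hin i hi.1
      exact ⟨(hsep i hi.1).resolve_left hi.2, h₂, h₃⟩
    have := hl.add ha (by simp only; linarith) (by simp only; linarith)
      (by simp only; linarith) hr
    rw [card_filter_split S T fun i => (p i).x2 ≤ c,
      card_filter_split S (fun i => ¬ T i) fun i => (p i).x2 ≤ c]
    simp only at this
    rwa [show c - R.x1 + (R.x2 - c) = R.x2 - R.x1 by ring] at this
  | horiz S R c h1 h2 hsep _ _ ihb iht =>
    have hl := ihb hx h1 hx1 (by simp only; linarith) fun i hi => by
      rw [Finset.mem_filter] at hi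
      obtain ⟨h₁, h₂, h₃, -⟩ := hin i hi.1
      exact ⟨h₁, h₂, h₃, hi.2⟩
    have hr := iht hx h2 hx1 (by simp only; linarith) fun i hi => by
      rw [Finset.mem_filter] at hi
      obtain ⟨h₁, h₂, -, h₄⟩ := hin i hi.1
      exact ⟨h₁, h₂, (hsep i hi.1).resolve_left hi.2, h₄⟩
    have := (hl.swap.add ha (by simp only; linarith) (by simp only; linarith)
      (by simp only; linarith) hr.swap).swap
    rw [card_filter_split S T fun i => (p i).y2 ≤ c,
      card_filter_split S (fun i => ¬ T i) fun i => (p i).y2 ≤ c]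
    simp only at this
    rwa [show c - R.y1 + (R.y2 - c) = R.y2 - R.y1 by ring] at this

/-- A guillotinable bin holds at most `3 / (2b)` wide and tall items in total. -/
theorem BinPacking.Guillotinable.card_bin_mul_le {n N : ℕ} {a b : ℝ} (ha : 1/2 < a)
    {P : BinPacking (Sum.elim (fun _ : Fin n => a) (fun _ : Fin n => b))
      (Sum.elim (fun _ : Fin n => b) (fun _ : Fin n => a)) N}
    (hP : P.Guillotinable) (c : Fin N) :
    (Finset.univ.filter fun i => P.bin i = c).card * b ≤ 3/2 := by
  have h := (hP c).countBound (fun i => i.isLeft = true) (a := a) (b := b) ha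
    (by rintro (i | i) hi <;> simp_all [BinPacking.rect])
    (by rintro (i | i) hi <;> simp_all [BinPacking.rect])
    zero_le_one zero_le_one (by norm_num) (by norm_num)
    (fun i _ => ⟨P.x_nonneg i, P.x_add_le i, P.y_nonneg i, P.y_add_le i⟩)
  rw [← Finset.card_filter_add_card_filter_not (s := Finset.univ.filter fun i => P.bin i = c)
    (fun i => i.isLeft = true)]
  push_cast
  exact h.add_mul_le (by norm_num) (by norm_num)

theorem BinPacking.Guillotinable.card_mul_le {n N : ℕ} {a b : ℝ} (ha : 1/2 < a)
    {P : BinPacking (Sum.elim (fun _ : Fin n => a) (fun _ : Fin n => b))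
      (Sum.elim (fun _ : Fin n => b) (fun _ : Fin n => a)) N}
    (hP : P.Guillotinable) : (n + n) * b ≤ N * (3/2) := by
  have hcard := Finset.card_eq_sum_card_fiberwise (f := P.bin) (s := Finset.univ)
    (t := Finset.univ) (fun _ _ => Finset.mem_coe.2 (Finset.mem_univ _))
  rw [Finset.card_univ, Fintype.card_sum, Fintype.card_fin] at hcard
  calc ((n : ℝ) + n) * b = ∑ c : Fin N, (Finset.univ.filter fun i => P.bin i = c).card * b := by
        rw [← Finset.sum_mul]
        exact_mod_cast congrArg (fun x : ℕ => (x : ℝ) * b) hcard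
    _ ≤ ∑ _c : Fin N, (3/2 : ℝ) := Finset.sum_le_sum fun c _ => hP.card_bin_mul_le ha c
    _ = N * (3/2) := by simp

/-- If every item fits into a unit bin, then `optg` is attained: packing one item per bin is
guillotinable. -/
theorem exists_guillotinable_optg {ι : Type} [Fintype ι] {w h : ι → ℝ} (hw : ∀ i, w i ≤ 1)
    (hh : ∀ i, h i ≤ 1) : ∃ P : BinPacking w h (optg w h), P.Guillotinable := by
  refine Nat.sInf_mem (s := {N | ∃ P : BinPacking w h N, P.Guillotinable}) ⟨Fintype.card ι,
    { bin := Fintype.equivFin ι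
      x := 0
      y := 0
      x_nonneg := fun _ => le_rfl
      y_nonneg := fun _ => le_rfl
      x_add_le := by simpa using hw
      y_add_le := by simpa using hh
      disj := fun i j hij h => absurd ((Fintype.equivFin ι).injective h) hij }, fun b => ?_⟩
  refine Guillotine.leaf _ _ (Finset.card_le_one.2 fun i hi j hj => ?_)
  simp only [Finset.mem_filter] at hi hj
  exact (Fintype.equivFin ι).injective (hi.2.trans hj.2.symm)

/-- Lower bound on the asymptotic price of guillotinability:
for the instance `I` consisting of `2mk` items of width `(1+ε)/2` and height
`(1−ε)/(2k)` together with `2mk` items of width `(1−ε)/(2k)` and height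
`(1+ε)/2`, we have `opt_g(I) ≥ (4/3)(1−ε)·opt(I)`. -/
theorem apog_lower_bound
    (m k : ℕ) (hm : 0 < m) (hk : 0 < k) (ε : ℝ) (hε0 : 0 < ε) (hε1 : ε < 1) :
    4/3 * (1 - ε) *
      (opt (Sum.elim (fun _ : Fin (2*m*k) => (1+ε)/2)
              (fun _ : Fin (2*m*k) => (1-ε)/(2*(k:ℝ))))
           (Sum.elim (fun _ : Fin (2*m*k) => (1-ε)/(2*(k:ℝ)))
              (fun _ : Fin (2*m*k) => (1+ε)/2)) : ℝ)
    ≤ (optg (Sum.elim (fun _ : Fin (2*m*k) => (1+ε)/2)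
              (fun _ : Fin (2*m*k) => (1-ε)/(2*(k:ℝ))))
            (Sum.elim (fun _ : Fin (2*m*k) => (1-ε)/(2*(k:ℝ)))
              (fun _ : Fin (2*m*k) => (1+ε)/2)) : ℝ) := by
  have hk' : (0 : ℝ) < k := by exact_mod_cast hk
  have hk1 : (1 : ℝ) ≤ k := by exact_mod_cast hk
  have hb : 0 ≤ (1 - ε) / (2 * (k : ℝ)) := div_nonneg (by linarith) (by positivity)
  have hkb : k * ((1 - ε) / (2 * (k : ℝ))) = (1 - ε) / 2 := by field_simp
  have hopt := Nat.sInf_le (s := {N | Nonempty (BinPacking _ _ N)})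
    ⟨pinwheelPacking m k hk ((1 + ε) / 2) ((1 - ε) / (2 * (k : ℝ))) hb
      (by linarith) (by linarith)⟩
  have hb1 : (1 - ε) / (2 * (k : ℝ)) ≤ 1 := by nlinarith
  obtain ⟨P, hP⟩ := exists_guillotinable_optg
    (w := Sum.elim (fun _ : Fin (2*m*k) => (1+ε)/2) (fun _ : Fin (2*m*k) => (1-ε)/(2*(k:ℝ))))
    (h := Sum.elim (fun _ : Fin (2*m*k) => (1-ε)/(2*(k:ℝ))) (fun _ : Fin (2*m*k) => (1+ε)/2))
    (by rintro (i | i) <;> simp only [Sum.elim_inl, Sum.elim_inr] <;> linarith)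
    (by rintro (i | i) <;> simp only [Sum.elim_inl, Sum.elim_inr] <;> linarith)
  have hcount := hP.card_mul_le (by linarith)
  have hitems : (((2*m*k : ℕ) : ℝ) + (2*m*k : ℕ)) * ((1 - ε) / (2 * (k : ℝ)))
      = 2 * m * (1 - ε) := by
    push_cast
    linear_combination (4 * (m : ℝ)) * hkb
  rw [hitems] at hcount
  refine (mul_le_mul_of_nonneg_left (Nat.cast_le.2 hopt) (by linarith)).trans ?_
  linarith
end

section
/- Let ε, ε₁ ∈ (0, 1/2] with ε₁ ≤ ε and 1/ε₁ ∈ ℤ, let ε₂ ∈ (0, ε₁], and let R be a finite subset of (ε₁, 1] with |R| ≤ 1/(ε·ε₁). Define 𝒯 := T_{1/ε₁ − 1}, where T_0 := {0}, t_j := (1 + 1/(ε·ε₁))^{2j}, δ_j := ε·ε₁/t_{j−1}, S_j := T_{j−1} ∪ { k·δ_j : k ∈ ℤ, 0 ≤ k < 1/δ_j }, and T_j := { x + y : x ∈ S_j, y ∈ R ∪ {0} }. Let J be a finite set of items packed into a single unit square bin, where every item is either wide (width in R and height ≤ ε₂), tall (height > ε₁ and width ≤ ε₂), or small (width ≤ ε₂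 and height ≤ ε₂). Then one can slice the tall items by vertical cuts and the small items by horizontal and vertical cuts, discard a collection of the resulting slices of total area less than ε, and pack all the wide items together with all remaining slices into the unit bin so that every wide item i has both the x-coordinate of its left edge and the x-coordinate of its right edge in 𝒯. -/
/-- `GPartition R L` : the list `L` of rectangles is obtained from the
rectangle `R` by recursively applying end-to-end horizontal and vertical
cuts (i.e., it is a guillotine partition of `R`). -/
inductive GPartition : Rect → List Rect → Prop
  | leaf (R : Rect) : GPartition R [R]
  | vert (R : Rect) (c : ℝ) (L1 L2 : List Rect) (h1 : R.x1 ≤ c) (h2 : c ≤ R.x2)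
      (hl : GPartition ⟨R.x1, R.y1, c, R.y2⟩ L1)
      (hr : GPartition ⟨c, R.y1, R.x2, R.y2⟩ L2) : GPartition R (L1 ++ L2)
  | horiz (R : Rect) (c : ℝ) (L1 L2 : List Rect) (h1 : R.y1 ≤ c) (h2 : c ≤ R.y2)
      (hb : GPartition ⟨R.x1, R.y1, R.x2, c⟩ L1)
      (ht : GPartition ⟨R.x1, c, R.x2, R.y2⟩ L2) : GPartition R (L1 ++ L2)

/-- Vertical cuts at the points of a finite set `B` divide a rectangle into strips. -/
theorem exists_vertical_cuts (B : Finset ℝ) (lo hi : ℝ) (hlt : lo < hi) :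
    ∃ L : List (ℝ × ℝ),
      (∀ p ∈ L, lo ≤ p.1 ∧ p.1 < p.2 ∧ p.2 ≤ hi ∧ ∀ b ∈ B, b ≤ p.1 ∨ p.2 ≤ b) ∧
      L.Pairwise (fun p q => p.2 ≤ q.1) ∧
      (L.map (fun p => p.2 - p.1)).sum = hi - lo ∧
      ∀ o y0 y1, GPartition ⟨lo - o, y0, hi - o, y1⟩
        (L.map (fun p => ⟨p.1 - o, y0, p.2 - o, y1⟩)) := by
  induction hk : (B.filter (fun b => lo < b ∧ b < hi)).card using Nat.strong_induction_on
    generalizing lo hi with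
  | _ k ih =>
  by_cases hB : ∃ b ∈ B, lo < b ∧ b < hi
  · obtain ⟨b, hb, h1, h2⟩ := hB
    have hbmem : b ∈ B.filter (fun b => lo < b ∧ b < hi) := by simp [hb, h1, h2]
    obtain ⟨L1, m1, p1, s1, g1⟩ := ih _ (by
      rw [← hk]
      refine Finset.card_lt_card (Finset.ssubset_iff_of_subset ?_ |>.2 ⟨b, hbmem, by simp⟩)
      intro z
      simp only [Finset.mem_filter]
      rintro ⟨a, c, d⟩
      exact ⟨a, c, d.trans h2⟩) lo b h1 rfl
    obtain ⟨L2, m2, p2, s2, g2⟩ := ih _ (by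
      rw [← hk]
      refine Finset.card_lt_card (Finset.ssubset_iff_of_subset ?_ |>.2 ⟨b, hbmem, by simp⟩)
      intro z
      simp only [Finset.mem_filter]
      rintro ⟨a, c, d⟩
      exact ⟨a, h1.trans c, d⟩) b hi h2 rfl
    refine ⟨L1 ++ L2, ?_, ?_, ?_, ?_⟩
    · intro p hp
      rcases List.mem_append.1 hp with hp | hp
      · obtain ⟨a, c, d, e⟩ := m1 p hp
        exact ⟨a, c, d.trans h2.le, e⟩
      · obtain ⟨a, c, d, e⟩ := m2 p hp
        exact ⟨h1.le.trans a, c, d, e⟩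
    · refine List.pairwise_append.2 ⟨p1, p2, fun p hp q hq => ?_⟩
      exact (m1 p hp).2.2.1.trans (m2 q hq).1
    · simp [s1, s2]
    · intro o y0 y1
      rw [List.map_append]
      exact .vert _ (b - o) _ _ (sub_le_sub_right h1.le o) (sub_le_sub_right h2.le o)
        (g1 o y0 y1) (g2 o y0 y1)
  · push Not at hB
    refine ⟨[(lo, hi)], ?_, by simp, by simp, fun o y0 y1 => .leaf _⟩
    intro p hp
    obtain rfl : p = (lo, hi) := by simpa using hp
    refine ⟨le_rfl, hlt, le_rfl, fun b hb => ?_⟩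
    by_cases hl : lo < b
    · exact Or.inr (hB b hb hl)
    · exact Or.inl (not_lt.1 hl)

/-- The preimage of a half-open interval under an expanding map lies in a half-open interval of
the same length. -/
theorem exists_interval_of_expanding {f : ℝ → ℝ} (hf : ∀ u v, u ≤ v → f u + (v - u) ≤ f v)
    (a d : ℝ) : ∃ c, ∀ u, a ≤ f u → f u < a + d → c ≤ u ∧ u < c + d := by
  by_cases hne : ∃ u, a ≤ f u ∧ f u < a + d
  · obtain ⟨u₀, h₀, h₀'⟩ := hne
    have hlow : ∀ u v, a ≤ f u → a ≤ f v → u - (f u - a) ≤ v := by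
      intro u v hu hv
      rcases le_total v u with h | h
      · have := hf v u h
        linarith
      · linarith
    have hbdd : BddBelow {u | a ≤ f u ∧ f u < a + d} :=
      ⟨u₀ - (f u₀ - a), fun v hv => hlow u₀ v h₀ hv.1⟩
    refine ⟨sInf {u | a ≤ f u ∧ f u < a + d}, fun u hu hu' => ⟨csInf_le hbdd ⟨hu, hu'⟩, ?_⟩⟩
    have : u - (f u - a) ≤ sInf {u | a ≤ f u ∧ f u < a + d} :=
      le_csInf ⟨u₀, h₀, h₀'⟩ fun v hv => hlow u v hu hv.1
    linarith
  · push Not at hne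
    exact ⟨0, fun u h1 h2 => absurd h2 (not_lt.2 (hne u h1))⟩

theorem disjoint_Ioo_prod_iff {a b c d a' b' c' d' : ℝ} (h1 : a < b) (h2 : c < d)
    (h1' : a' < b') (h2' : c' < d') :
    (Set.Ioo a b ×ˢ Set.Ioo c d) ∩ (Set.Ioo a' b' ×ˢ Set.Ioo c' d') = ∅ ↔
      (b ≤ a' ∨ b' ≤ a) ∨ (d ≤ c' ∨ d' ≤ c) := by
  rw [Set.prod_inter_prod, Set.prod_eq_empty_iff, Set.Ioo_inter_Ioo, Set.Ioo_inter_Ioo,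
    Set.Ioo_eq_empty_iff, Set.Ioo_eq_empty_iff]
  simp only [sup_lt_iff, lt_inf_iff, not_and_or, not_lt]
  constructor
  · rintro ((h | h) | (h | h)) <;> grind
  · grind

/-- The map moving `u` left by `d k` for every `k < N` such that `u < (k + 1) * e`. -/
noncomputable def leftShift (e : ℝ) (d : ℕ → ℝ) : ℕ → ℝ → ℝ
  | 0, u => u
  | k + 1, u => leftShift e d k u - if u < (k + 1) * e then d k else 0

section leftShift

variable {e : ℝ} {d : ℕ → ℝ}

theorem leftShift_expanding (hd : ∀ k, 0 ≤ d k) (k : ℕ) (u v : ℝ) (huv : u ≤ v) :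
    leftShift e d k u + (v - u) ≤ leftShift e d k v := by
  induction k with
  | zero => simp [leftShift]
  | succ k ih =>
    have := hd k
    simp only [leftShift]
    split_ifs <;> linarith

theorem leftShift_antitone (hd : ∀ k, 0 ≤ d k) (u : ℝ) :
    Antitone (fun k => leftShift e d k u) := by
  refine antitone_nat_of_succ_le fun k => ?_
  have := hd k
  simp only [leftShift]
  split_ifs <;> linarith

theorem leftShift_eq_self (he : 0 ≤ e) {k : ℕ} {u : ℝ} (hu : k * e ≤ u) :
    leftShift e d k u = u := by
  induction k with
  | zero => rfl
  | succ k ih =>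
    push_cast at hu
    simp only [leftShift]
    rw [if_neg (not_lt.2 hu), ih (by nlinarith), sub_zero]

theorem le_leftShift {A : ℕ → Finset ℝ} (hA : Monotone A) (he : 0 ≤ e)
    {N : ℕ} {u : ℝ}
    (hu : ∀ k < N, ∀ a ∈ A k, a ≤ leftShift e d k u → a + d k ≤ leftShift e d k u)
    {k₀ : ℕ} {b : ℝ} (hb : b ∈ A k₀) (hbu : b ≤ u) (hk₀ : k₀ * e ≤ u)
    {k : ℕ} (hk : k₀ ≤ k) (hkN : k ≤ N) :
    b ≤ leftShift e d k u := by
  induction k, hk using Nat.le_induction with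
  | base => rwa [leftShift_eq_self he hk₀]
  | succ k hk ih =>
    have h1 := ih (by lia)
    have h2 := hu k (by lia) b (hA hk hb) h1
    simp only [leftShift]
    split_ifs <;> linarith

end leftShift

/-- One-dimensional form of the discretization: intervals `[x i, x i + w i]` are moved to
positions with endpoints in `A N`, and the points outside finitely many short intervals are moved
by an expanding map compatible with the new positions. -/
theorem exists_discretized_intervals {ι : Type*} {e ε : ℝ} (he : 0 < e)
    {N : ℕ} (hN : (N + 1 : ℝ) * e = 1)
    {d : ℕ → ℝ} (hd : ∀ k, 0 < d k)
    {A : ℕ → Finset ℝ} {P : ℕ → Finset ℝ} (hA0 : A 0 = {0})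
    (hP : ∀ k v, v ∈ P k ↔
      v ∈ A k ∨ ∃ z : ℤ, 0 ≤ z ∧ (z : ℝ) < 1 / d k ∧ v = (z : ℝ) * d k)
    (R : Finset ℝ) (hA : ∀ k v, v ∈ A (k + 1) ↔ ∃ s ∈ P k, ∃ u ∈ insert (0 : ℝ) R, v = s + u)
    (hcost : ∑ k ∈ Finset.range N, (A k).card * d k < ε)
    (x w : ι → ℝ) (hwR : ∀ i, w i ∈ R) (hwe : ∀ i, e < w i)
    (hx : ∀ i, 0 ≤ x i) (hx1 : ∀ i, x i + w i ≤ 1) :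
    ∃ (X : ι → ℝ) (g : ℝ → ℝ) (κ : Type) (I : Finset κ) (c l : κ → ℝ),
      (∀ i, 0 ≤ X i ∧ X i ≤ x i ∧ X i ∈ A N ∧ X i + w i ∈ A N) ∧
      (∀ i j, x i + w i ≤ x j → X i + w i ≤ X j) ∧
      (∀ u v, u ≤ v → g u + (v - u) ≤ g v) ∧
      (∀ u, g u ≤ u) ∧
      (∀ u, 0 ≤ u → (∀ k ∈ I, c k ≤ u → c k + l k ≤ u) →
        0 ≤ g u ∧ ∀ i, x i + w i ≤ u → X i + w i ≤ g u) ∧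
      (∀ u v i, u < v → v ≤ x i → g u + (v - u) ≤ X i) ∧
      (∀ k, 0 ≤ l k) ∧ ∑ k ∈ I, l k < ε := by
  have hd' : ∀ k, 0 ≤ d k := fun k => (hd k).le
  have hPA : ∀ k, P k ⊆ A (k + 1) := fun k v hv =>
    (hA k v).2 ⟨v, hv, 0, by simp, by simp⟩
  have hAP : ∀ k, A k ⊆ P k := fun k v hv => (hP k v).2 (Or.inl hv)
  have hmono : Monotone A := monotone_nat_of_le_succ fun k => (hAP k).trans (hPA k)
  have h0A : ∀ k, (0 : ℝ) ∈ A k := fun k => hmono (Nat.zero_le k) (by simp [hA0])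
  set lev : ι → ℕ := fun i => ⌊x i / e⌋₊ with hlev
  have hlev1 : ∀ i, lev i * e ≤ x i := fun i => by
    have := Nat.floor_le (div_nonneg (hx i) he.le)
    rwa [le_div_iff₀ he] at this
  have hlev2 : ∀ i, x i < (lev i + 1) * e := fun i => by
    have := Nat.lt_floor_add_one (x i / e)
    rwa [div_lt_iff₀ he] at this
  have hlevN : ∀ i, lev i + 1 ≤ N := fun i => by
    have h1 := hlev1 i
    have h2 := hwe i
    have h3 := hx1 i
    have : (lev i : ℝ) < N := by
      by_contra! h
      nlinarith
    exact_mod_cast this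
  have hsnap : ∀ i, ∃ s ∈ P (lev i), s ≤ x i ∧ ∀ s' ∈ P (lev i), s' ≤ x i → s' ≤ s := by
    intro i
    have hne : ((P (lev i)).filter (· ≤ x i)).Nonempty :=
      ⟨0, by simp [hAP _ (h0A _), hx i]⟩
    obtain ⟨s, hs, hmax⟩ := Finset.exists_max_image _ id hne
    rw [Finset.mem_filter] at hs
    exact ⟨s, hs.1, hs.2, fun s' h1 h2 => hmax s' (by simp [h1, h2])⟩
  choose X hXP hXx hXmax using hsnap
  have hXlow : ∀ i, x i - d (lev i) < X i := by
    intro i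
    have hdi := hd (lev i)
    have hfl := Int.floor_le (x i / d (lev i))
    have hfl' := Int.lt_floor_add_one (x i / d (lev i))
    rw [le_div_iff₀ hdi] at hfl
    rw [div_lt_iff₀ hdi] at hfl'
    have hmem : (⌊x i / d (lev i)⌋ : ℝ) * d (lev i) ∈ P (lev i) := by
      refine (hP _ _).2 (Or.inr ⟨_, Int.floor_nonneg.2 (div_nonneg (hx i) hdi.le), ?_, rfl⟩)
      rw [lt_div_iff₀ hdi]
      have := hwe i
      have := hx1 i
      linarith
    have := hXmax i _ hmem hfl
    linarith
  have hXw : ∀ i, X i + w i ∈ A (lev i + 1) := fun i =>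
    (hA _ _).2 ⟨_, hXP i, w i, Finset.mem_insert_of_mem (hwR i), rfl⟩
  have hexp := leftShift_expanding (e := e) hd'
  choose c hc using fun (k : ℕ) (a : ℝ) => exists_interval_of_expanding (hexp k) a (d k)
  refine ⟨X, leftShift e d N, (_ : ℕ) × ℝ, (Finset.range N).sigma A, fun q => c q.1 q.2,
    fun q => d q.1, ?_, ?_, hexp N, ?_, ?_, ?_, fun q => hd' _, ?_⟩
  · intro i
    exact ⟨hXmax i 0 (hAP _ (h0A _)) (hx i), hXx i, hmono (hlevN i) (hPA _ (hXP i)),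
      hmono (hlevN i) (hXw i)⟩
  · intro i j hij
    refine hXmax j _ (hAP _ (hmono ?_ (hXw i))) (by linarith [hXx i])
    have h1 := hlev1 i
    have h2 := hlev2 j
    have h3 := hwe i
    have : (lev i : ℝ) < lev j := by
      by_contra! h
      nlinarith
    exact_mod_cast this
  · intro u
    exact leftShift_antitone hd' u (Nat.zero_le N)
  · intro u hu hgood
    have hgood' : ∀ k < N, ∀ a ∈ A k, a ≤ leftShift e d k u →
        a + d k ≤ leftShift e d k u := by
      intro k hk a ha h1
      by_contra! h2
      obtain ⟨h3, h4⟩ := hc k a u h1 h2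
      have := hgood ⟨k, a⟩ (by simp [hk, ha]) h3
      simp only at this
      linarith
    refine ⟨le_leftShift hmono he.le hgood' (h0A 0) hu (by simpa using hu) (Nat.zero_le N) le_rfl,
      fun i hi => le_leftShift hmono he.le hgood' (hXw i) (by linarith [hXx i]) ?_
        (hlevN i) le_rfl⟩
    have h1 := hlev1 i
    have h2 := hwe i
    push_cast
    linarith
  · intro u v i huv hv
    have h1 : leftShift e d N u ≤ leftShift e d (lev i + 1) u :=
      leftShift_antitone hd' u (hlevN i)
    have h2 : leftShift e d (lev i) u ≤ u := leftShift_antitone hd' u (Nat.zero_le _)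
    have h3 : leftShift e d (lev i + 1) u = leftShift e d (lev i) u - d (lev i) := by
      rw [leftShift, if_pos (by linarith [hlev2 i])]
    linarith [hXlow i]
  · rw [Finset.sum_sigma]
    simpa using hcost

/-- Cardinality bound for the sets of admissible positions. -/
theorem card_positions_le {q : ℝ} (hq : 0 < q) {d : ℕ → ℝ}
    (hd : ∀ k, d k = 1 / (q * (1 + q) ^ (2 * k)))
    {A : ℕ → Finset ℝ} {P : ℕ → Finset ℝ} (hA0 : A 0 = {0})
    (hP : ∀ k v, v ∈ P k ↔
      v ∈ A k ∨ ∃ z : ℤ, 0 ≤ z ∧ (z : ℝ) < 1 / d k ∧ v = (z : ℝ) * d k)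
    (R : Finset ℝ) (hR : (R.card : ℝ) ≤ q)
    (hA : ∀ k v, v ∈ A (k + 1) ↔ ∃ s ∈ P k, ∃ u ∈ insert (0 : ℝ) R, v = s + u) (k : ℕ) :
    0 ∈ A k ∧ ((A k).card : ℝ) ≤ (1 + q) ^ (2 * k) := by
  induction k with
  | zero => simp [hA0]
  | succ k ih =>
    obtain ⟨h0, hcard⟩ := ih
    have hinv : 1 / d k = q * (1 + q) ^ (2 * k) := by rw [hd, one_div_one_div]
    have hpos : 0 < 1 / d k := by rw [hinv]; positivity
    refine ⟨(hA k 0).2 ⟨0, (hP k 0).2 (Or.inl h0), 0, by simp, by simp⟩, ?_⟩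
    have hPcard : ((P k).card : ℝ) ≤ (A k).card + 1 / d k := by
      have hsub : P k ⊆ A k ∪
          (Finset.Icc 1 ⌊1 / d k⌋₊).image (fun z : ℕ => (z : ℝ) * d k) := by
        intro v hv
        rcases (hP k v).1 hv with h | ⟨z, hz0, hz1, rfl⟩
        · exact Finset.mem_union_left _ h
        · lift z to ℕ using hz0
          rcases Nat.eq_zero_or_pos z with rfl | hz
          · exact Finset.mem_union_left _ (by simpa using h0)
          · refine Finset.mem_union_right _ (Finset.mem_image.2 ⟨z, ?_, by simp⟩)
            exact Finset.mem_Icc.2 ⟨hz, Nat.le_floor (by exact_mod_cast hz1.le)⟩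
      have h1 := (Finset.card_le_card hsub).trans (Finset.card_union_le _ _)
      have h2 := Finset.card_image_le (s := Finset.Icc 1 ⌊1 / d k⌋₊)
        (f := fun z : ℕ => (z : ℝ) * d k)
      rw [Nat.card_Icc, Nat.add_sub_cancel] at h2
      have h3 := Nat.floor_le hpos.le
      have h4 : ((P k).card : ℝ) ≤ (A k).card + ⌊1 / d k⌋₊ := by
        exact_mod_cast h1.trans (Nat.add_le_add_left h2 _)
      linarith
    have hsub : A (k + 1) ⊆ (P k ×ˢ insert (0 : ℝ) R).image (fun p => p.1 + p.2) := by
      intro v hv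
      obtain ⟨s, hs, u, hu, rfl⟩ := (hA k v).1 hv
      exact Finset.mem_image.2 ⟨(s, u), Finset.mem_product.2 ⟨hs, hu⟩, rfl⟩
    have h1 := (Finset.card_le_card hsub).trans Finset.card_image_le
    rw [Finset.card_product] at h1
    have h2 : ((A (k + 1)).card : ℝ) ≤ (P k).card * (R.card + 1) := by
      exact_mod_cast h1.trans (Nat.mul_le_mul_left _ (Finset.card_insert_le _ _))
    calc ((A (k + 1)).card : ℝ) ≤ (P k).card * (R.card + 1) := h2
      _ ≤ ((1 + q) ^ (2 * k) + q * (1 + q) ^ (2 * k)) * (q + 1) := by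
          rw [← hinv]
          gcongr
          linarith
      _ = (1 + q) ^ (2 * (k + 1)) := by ring

open MeasureTheory in
/-- Pairwise disjoint rectangles inside the union of the vertical strips `[c k, c k + l k] × [0, 1]`
have total area at most the total width of the strips. -/
theorem sum_area_le_of_subset_strips {σ κ : Type*} (F : Finset σ) (I : Finset κ)
    (a b W H : σ → ℝ) (hW : ∀ s, 0 < W s) (hH : ∀ s, 0 < H s)
    (hdisj : ∀ s s', s ≠ s' →
      (Set.Ioo (a s) (a s + W s) ×ˢ Set.Ioo (b s) (b s + H s)) ∩
        (Set.Ioo (a s') (a s' + W s') ×ˢ Set.Ioo (b s') (b s' + H s')) = ∅)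
    (hb : ∀ s, 0 ≤ b s ∧ b s + H s ≤ 1)
    (c l : κ → ℝ) (hl : ∀ k, 0 ≤ l k)
    (hsub : ∀ s ∈ F, ∃ k ∈ I, c k ≤ a s ∧ a s + W s ≤ c k + l k) :
    ∑ s ∈ F, W s * H s ≤ ∑ k ∈ I, l k := by
  have hvol : ∀ u v p q : ℝ, volume (Set.Ioo u (u + p) ×ˢ Set.Ioo v (v + q)) =
      ENNReal.ofReal p * ENNReal.ofReal q := by
    intro u v p q
    rw [Measure.volume_eq_prod, Measure.prod_prod, Real.volume_Ioo, Real.volume_Ioo]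
    simp
  have key : volume (⋃ s ∈ F, Set.Ioo (a s) (a s + W s) ×ˢ Set.Ioo (b s) (b s + H s)) ≤
      volume (⋃ k ∈ I, Set.Ioo (c k) (c k + l k) ×ˢ Set.Ioo (0 : ℝ) (0 + 1)) := by
    refine measure_mono (Set.iUnion₂_subset fun s hs => ?_)
    obtain ⟨k, hk, h1, h2⟩ := hsub s hs
    refine Set.subset_iUnion₂_of_subset k hk (Set.prod_mono (Set.Ioo_subset_Ioo h1 h2) ?_)
    exact Set.Ioo_subset_Ioo (hb s).1 (by linarith [(hb s).2])
  rw [measure_biUnion_finset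
    (fun s _ s' _ hne => Set.disjoint_iff_inter_eq_empty.2 (hdisj s s' hne))
    (fun s _ => measurableSet_Ioo.prod measurableSet_Ioo)] at key
  replace key := key.trans (measure_biUnion_finset_le _ _)
  simp only [hvol, ENNReal.ofReal_one, mul_one] at key
  rw [← ENNReal.ofReal_sum_of_nonneg fun k _ => hl k] at key
  simp only [← ENNReal.ofReal_mul (hW _).le] at key
  rw [← ENNReal.ofReal_sum_of_nonneg fun s _ => (mul_pos (hW s) (hH s)).le] at key
  exact (ENNReal.ofReal_le_ofReal_iff (Finset.sum_nonneg fun k _ => hl k)).1 key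

/-- The elements of a finite sigma type of list positions lying over `j`, mapped through the list
entries, form the list over `j`. -/
theorem filter_owner_map {n : ℕ} {α β : Type*} (L : Fin n → List α) (f : Fin n → α → β)
    (j : Fin n) :
    (Finset.univ.filter (fun s : Fin (∑ i, (L i).length) =>
      (finSigmaFinEquiv.symm s).1 = j)).val.map
      (fun s => f (finSigmaFinEquiv.symm s).1
        ((L (finSigmaFinEquiv.symm s).1).get (finSigmaFinEquiv.symm s).2)) =
      ((L j).map (f j) : Multiset β) := by
  have hfil : Finset.univ.filter (fun s : Fin (∑ i, (L i).length) =>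
      (finSigmaFinEquiv.symm s).1 = j) =
      Finset.univ.map ((Function.Embedding.sigmaMk (β := fun i => Fin (L i).length) j).trans
        finSigmaFinEquiv.toEmbedding) := by
    ext s
    obtain ⟨⟨i, k⟩, rfl⟩ := finSigmaFinEquiv.surjective s
    simp only [Finset.mem_filter, Finset.mem_univ, true_and, Equiv.symm_apply_apply,
      Finset.mem_map, Function.Embedding.trans_apply, Equiv.coe_toEmbedding,
      EmbeddingLike.apply_eq_iff_eq, Function.Embedding.sigmaMk_apply]
    constructor
    · rintro rfl
      exact ⟨k, rfl⟩
    · rintro ⟨a, ha⟩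
      exact (congrArg Sigma.fst ha).symm
  rw [hfil, Finset.map_val, Multiset.map_map]
  have hsymm : ∀ F : (Σ i, Fin (L i).length) → β,
      Multiset.map (fun k => F (finSigmaFinEquiv.symm (finSigmaFinEquiv ⟨j, k⟩)))
        Finset.univ.val = Multiset.map (fun k => F ⟨j, k⟩) Finset.univ.val := fun F => by
    simp only [Equiv.symm_apply_apply]
  refine (hsymm fun a => f a.1 ((L a.1).get a.2)).trans ?_
  rw [Fin.univ_val_map]
  congr 1
  exact List.ext_getElem (by simp) fun k h1 h2 => by simp

set_option maxHeartbeats 400000 in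
/-- Discretization of the horizontal positions of wide
items: given a packing of wide/tall/small items into a unit bin, one can
slice the tall items by vertical cuts and the small items by horizontal and
vertical cuts, discard slices of total area less than `ε`, and repack all the
wide items together with the remaining slices into the unit bin so that the
left and right edges of every wide item have `x`-coordinates in
`𝒯 = T_{1/ε₁ − 1}`. -/
theorem discretize_wide_positions
    (ε ε₁ ε₂ : ℝ) (hε0 : 0 < ε) (hεhalf : ε ≤ 1/2)
    (hε₁0 : 0 < ε₁) (hε₁half : ε₁ ≤ 1/2) (hε₁ε : ε₁ ≤ ε)
    (M : ℕ) (hM : (M : ℝ) = 1/ε₁)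
    (hε₂0 : 0 < ε₂) (hε₂ : ε₂ ≤ ε₁)
    (R : Finset ℝ) (hRmem : ∀ v ∈ R, ε₁ < v ∧ v ≤ 1)
    (hRcard : (R.card : ℝ) ≤ 1/(ε*ε₁))
    (t : ℕ → ℝ) (ht : ∀ j, t j = (1 + 1/(ε*ε₁))^(2*j))
    (δ : ℕ → ℝ) (hδ : ∀ j, 1 ≤ j → δ j = ε*ε₁ / t (j-1))
    (T S : ℕ → Finset ℝ)
    (hT0 : T 0 = {0})
    (hS : ∀ j, 1 ≤ j → ∀ v : ℝ,
      v ∈ S j ↔ v ∈ T (j-1) ∨ ∃ k : ℤ, 0 ≤ k ∧ (k : ℝ) < 1/(δ j) ∧ v = (k : ℝ) * δ j)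
    (hT : ∀ j, 1 ≤ j → ∀ v : ℝ,
      v ∈ T j ↔ ∃ s ∈ S j, ∃ u ∈ insert (0:ℝ) R, v = s + u)
    (n : ℕ) (w h : Fin n → ℝ)
    (hw : ∀ i, 0 < w i ∧ w i ≤ 1) (hh : ∀ i, 0 < h i ∧ h i ≤ 1)
    (Wide Tall Small : Fin n → Prop)
    (hWide : ∀ i, Wide i ↔ w i ∈ R ∧ h i ≤ ε₂)
    (hTall : ∀ i, Tall i ↔ ε₁ < h i ∧ w i ≤ ε₂)
    (hSmall : ∀ i, Small i ↔ w i ≤ ε₂ ∧ h i ≤ ε₂)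
    (hclass : ∀ i, Wide i ∨ Tall i ∨ Small i)
    (x y : Fin n → ℝ)
    (hin : ∀ i, 0 ≤ x i ∧ x i + w i ≤ 1 ∧ 0 ≤ y i ∧ y i + h i ≤ 1)
    (hdisj : ∀ i j, i ≠ j →
      (Set.Ioo (x i) (x i + w i) ×ˢ Set.Ioo (y i) (y i + h i)) ∩
        (Set.Ioo (x j) (x j + w j) ×ˢ Set.Ioo (y j) (y j + h j)) = ∅) :
    ∃ (m : ℕ) (owner : Fin m → Fin n) (w' h' : Fin m → ℝ),
      -- the slices have positive dimensions and come only from tall or small items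
      (∀ s, 0 < w' s ∧ 0 < h' s) ∧
      (∀ s, ¬ Wide (owner s)) ∧
      -- each tall item is sliced by vertical cuts
      (∀ j, Tall j → (∀ s, owner s = j → h' s = h j) ∧
        ∑ s ∈ Finset.univ.filter (fun s => owner s = j), w' s = w j) ∧
      -- each small item is sliced by horizontal and vertical cuts
      (∀ j, Small j → ∃ L : List Rect, GPartition ⟨0, 0, w j, h j⟩ L ∧
        (Finset.univ.filter (fun s => owner s = j)).val.map (fun s => (w' s, h' s)) =
          (↑(L.map (fun r => (r.x2 - r.x1, r.y2 - r.y1))) : Multiset (ℝ × ℝ))) ∧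
      -- a collection of slices of total area less than ε is discarded …
      ∃ keep : Finset (Fin m),
        (∑ s ∈ Finset.univ.filter (fun s => s ∉ keep), w' s * h' s) < ε ∧
        -- … and the wide items together with the remaining slices are packed
        -- into the unit bin, wide items with both edges at coordinates in 𝒯
        ∃ X Y : ({i : Fin n // Wide i} ⊕ {s : Fin m // s ∈ keep}) → ℝ,
          (∀ p, 0 ≤ X p ∧
            X p + Sum.elim (fun i => w i.1) (fun s => w' s.1) p ≤ 1 ∧
            0 ≤ Y p ∧
            Y p + Sum.elim (fun i => h i.1) (fun s => h' s.1) p ≤ 1) ∧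
          (∀ p q, p ≠ q →
            (Set.Ioo (X p) (X p + Sum.elim (fun i => w i.1) (fun s => w' s.1) p) ×ˢ
              Set.Ioo (Y p) (Y p + Sum.elim (fun i => h i.1) (fun s => h' s.1) p)) ∩
            (Set.Ioo (X q) (X q + Sum.elim (fun i => w i.1) (fun s => w' s.1) q) ×ˢ
              Set.Ioo (Y q) (Y q + Sum.elim (fun i => h i.1) (fun s => h' s.1) q)) = ∅) ∧
          (∀ i : {i : Fin n // Wide i},
            X (Sum.inl i) ∈ T (M - 1) ∧ X (Sum.inl i) + w i.1 ∈ T (M - 1)) := by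
  classical
  have hqpos : 0 < 1 / (ε * ε₁) := by positivity
  obtain ⟨N, rfl⟩ : ∃ N, M = N + 1 := by
    refine Nat.exists_eq_succ_of_ne_zero fun h0 => ?_
    rw [h0, Nat.cast_zero] at hM
    exact absurd hM.symm (by positivity)
  rw [Nat.add_sub_cancel]
  have hN : (N + 1 : ℝ) * ε₁ = 1 := by
    push_cast at hM
    rw [hM]
    field_simp
  set d : ℕ → ℝ := fun k => δ (k + 1) with hd_def
  have hd : ∀ k, d k = 1 / (1 / (ε * ε₁) * (1 + 1 / (ε * ε₁)) ^ (2 * k)) := fun k => by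
    rw [hd_def]
    simp only [hδ (k + 1) (by lia), Nat.add_sub_cancel, ht]
    rw [one_div_mul_eq_div, one_div_div]
  have hdpos : ∀ k, 0 < d k := fun k => by rw [hd]; positivity
  have hP : ∀ k v, v ∈ S (k + 1) ↔
      v ∈ T k ∨ ∃ z : ℤ, 0 ≤ z ∧ (z : ℝ) < 1 / d k ∧ v = (z : ℝ) * d k :=
    fun k v => hS (k + 1) (by lia) v
  have hA : ∀ k v, v ∈ T (k + 1) ↔ ∃ s ∈ S (k + 1), ∃ u ∈ insert (0 : ℝ) R, v = s + u :=
    fun k v => hT (k + 1) (by lia) v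
  have hcost : ∑ k ∈ Finset.range N, (T k).card * d k < ε := by
    have h1 : ∀ k ∈ Finset.range N, (T k).card * d k ≤ ε * ε₁ := by
      intro k _
      have := (card_positions_le (P := fun k => S (k + 1)) hqpos hd hT0 hP R hRcard hA k).2
      calc (T k).card * d k ≤ (1 + 1 / (ε * ε₁)) ^ (2 * k) * d k :=
            mul_le_mul_of_nonneg_right this (hdpos k).le
        _ = ε * ε₁ := by
            rw [hd, one_div_mul_eq_div, one_div_div]
            exact mul_div_cancel₀ _ (by positivity)
    refine (Finset.sum_le_card_nsmul _ _ _ h1).trans_lt ?_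
    rw [Finset.card_range, nsmul_eq_mul]
    nlinarith [mul_pos hε0 hε₁0]
  have hWw : ∀ i, Wide i → ε₁ < w i := fun i hi => (hRmem _ ((hWide i).1 hi).1).1
  obtain ⟨XW, g, κ, I, c, l, hXW, hWW, hgexp, hgle, hgood, hleft, hl, hlsum⟩ :=
    exists_discretized_intervals (ι := {i // Wide i}) (P := fun k => S (k + 1)) hε₁0 hN hdpos
      hT0 hP R hA hcost (fun i => x i.1) (fun i => w i.1)
      (fun i => ((hWide i.1).1 i.2).1) (fun i => hWw i.1 i.2)
      (fun i => (hin i.1).1) (fun i => (hin i.1).2.1)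
  choose L₀ hLmem hLpair hLsum hLpart using fun i =>
    exists_vertical_cuts (I.image fun k => c k + l k) (x i) (x i + w i) (by linarith [(hw i).1])
  set L : Fin n → List (ℝ × ℝ) := fun i => if Wide i then [] else L₀ i with hL
  have hLnot : ∀ j, ¬ Wide j → L j = L₀ j := fun j hj => by simp [hL, hj]
  set E := (finSigmaFinEquiv (n := fun i => (L i).length)).symm with hE
  set owner : Fin (∑ i, (L i).length) → Fin n := fun s => (E s).1 with howner
  set cell : Fin (∑ i, (L i).length) → ℝ × ℝ := fun s => (L (E s).1).get (E s).2 with hcell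
  have hownW : ∀ s, ¬ Wide (owner s) := by
    intro s hs
    have h1 := (E s).2.isLt
    have h2 : (L (E s).1).length = 0 := List.length_eq_zero_iff.2 (if_pos hs)
    lia
  have hcellmem : ∀ s, cell s ∈ L₀ (owner s) := fun s => by
    rw [← hLnot _ (hownW s)]
    exact List.get_mem _ _
  have hcellP := fun s => hLmem _ _ (hcellmem s)
  have hcelldisj : ∀ s s', s ≠ s' → owner s = owner s' →
      (cell s).2 ≤ (cell s').1 ∨ (cell s').2 ≤ (cell s).1 := by
    intro s s' hne ho
    have hpw : ∀ j, (L j).Pairwise (fun p q => p.2 ≤ q.1) := fun j => by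
      by_cases hj : Wide j
      · simp [hL, hj]
      · rw [hLnot j hj]
        exact hLpair j
    have hne' : E s ≠ E s' := fun h => hne (E.injective h)
    simp only [hcell]
    simp only [howner] at ho
    generalize E s = a at ho hne' ⊢
    generalize E s' = b at ho hne' ⊢
    obtain ⟨i, k⟩ := a
    obtain ⟨i', k'⟩ := b
    obtain rfl : i = i' := ho
    rcases lt_trichotomy k k' with h | h | h
    · exact Or.inl (List.pairwise_iff_get.1 (hpw i) _ _ h)
    · exact absurd (by rw [h]) hne'
    · exact Or.inr (List.pairwise_iff_get.1 (hpw i) _ _ h)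
  have hitem : ∀ i j, i ≠ j → (x i + w i ≤ x j ∨ x j + w j ≤ x i) ∨
      (y i + h i ≤ y j ∨ y j + h j ≤ y i) := fun i j hij =>
    (disjoint_Ioo_prod_iff (by linarith [(hw i).1]) (by linarith [(hh i).1])
      (by linarith [(hw j).1]) (by linarith [(hh j).1])).1 (hdisj i j hij)
  have hTallnot : ∀ j, Tall j → ¬ Wide j := fun j hj hj' => by
    linarith [hWw j hj', ((hTall j).1 hj).2]
  have hSmallnot : ∀ j, Small j → ¬ Wide j := fun j hj hj' => by
    linarith [hWw j hj', ((hSmall j).1 hj).1]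
  refine ⟨_, owner, fun s => (cell s).2 - (cell s).1, fun s => h (owner s),
    fun s => ⟨sub_pos.2 (hcellP s).2.1, (hh _).1⟩, hownW, ?_, ?_, ?_⟩
  · intro j hj
    refine ⟨fun s hs => congrArg h hs, ?_⟩
    have := congrArg Multiset.sum (filter_owner_map L (fun _ p => p.2 - p.1) j)
    rw [hLnot j (hTallnot j hj), Multiset.sum_coe, hLsum j, add_sub_cancel_left] at this
    exact this
  · intro j hj
    refine ⟨_, by simpa using hLpart j (x j) 0 (h j), ?_⟩
    have := filter_owner_map L (fun i p => (p.2 - p.1, h i)) j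
    rw [hLnot j (hSmallnot j hj)] at this
    refine this.trans ?_
    simp [Function.comp_def]
  set good : ℝ → Prop := fun u => ∀ k ∈ I, c k ≤ u → c k + l k ≤ u with hgooddef
  refine ⟨Finset.univ.filter (fun s => good (cell s).1), ?_, ?_⟩
  · refine lt_of_le_of_lt ?_ hlsum
    refine sum_area_le_of_subset_strips _ I (fun s => (cell s).1) (fun s => y (owner s)) _ _
      (fun s => sub_pos.2 (hcellP s).2.1) (fun s => (hh _).1) ?_ (fun s => (hin _).2.2) c l hl ?_
    · intro s s' hne
      refine (disjoint_Ioo_prod_iff (by linarith [(hcellP s).2.1])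
        (by linarith [(hh (owner s)).1]) (by linarith [(hcellP s').2.1])
        (by linarith [(hh (owner s')).1])).2 ?_
      simp only [add_sub_cancel]
      obtain ⟨a1, -, a2, -⟩ := hcellP s
      obtain ⟨b1, -, b2, -⟩ := hcellP s'
      by_cases ho : owner s = owner s'
      · exact Or.inl (hcelldisj s s' hne ho)
      · rcases hitem _ _ ho with (h1 | h1) | h1
        · exact Or.inl (Or.inl (by linarith))
        · exact Or.inl (Or.inr (by linarith))
        · exact Or.inr h1
    · intro s hs
      have hs' : ¬ good (cell s).1 := by simpa using hs
      simp only [hgooddef] at hs'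
      push Not at hs'
      obtain ⟨k, hk, h1, h2⟩ := hs'
      refine ⟨k, hk, h1, ?_⟩
      rw [add_sub_cancel]
      exact ((hcellP s).2.2.2 _ (Finset.mem_image_of_mem _ hk)).resolve_left (not_le.2 h2)
  set keep := Finset.univ.filter (fun s => good (cell s).1) with hkeep
  have hkgood : ∀ s : {s // s ∈ keep}, good (cell s.1).1 := fun s => (Finset.mem_filter.1 s.2).2
  set W : {i : Fin n // Wide i} ⊕ {s // s ∈ keep} → ℝ :=
    Sum.elim (fun i => w i.1) (fun s => (cell s.1).2 - (cell s.1).1) with hWdef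
  set H : {i : Fin n // Wide i} ⊕ {s // s ∈ keep} → ℝ :=
    Sum.elim (fun i => h i.1) (fun s => h (owner s.1)) with hHdef
  set X : {i : Fin n // Wide i} ⊕ {s // s ∈ keep} → ℝ :=
    Sum.elim XW (fun s => g (cell s.1).1) with hXdef
  set Y : {i : Fin n // Wide i} ⊕ {s // s ∈ keep} → ℝ :=
    Sum.elim (fun i => y i.1) (fun s => y (owner s.1)) with hYdef
  set O : {i : Fin n // Wide i} ⊕ {s // s ∈ keep} → ℝ :=
    Sum.elim (fun i => x i.1) (fun s => (cell s.1).1) with hOdef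
  have hcell0 : ∀ s, 0 ≤ (cell s).1 := fun s => (hin _).1.trans (hcellP s).1
  have hWpos : ∀ p, 0 < W p := by
    rintro (i | s)
    · exact (hw i.1).1
    · exact sub_pos.2 (hcellP s.1).2.1
  have hHpos : ∀ p, 0 < H p := by
    rintro (i | s)
    · exact (hh i.1).1
    · exact (hh _).1
  have hOdisj : ∀ p q, p ≠ q → (O p + W p ≤ O q ∨ O q + W q ≤ O p) ∨
      (Y p + H p ≤ Y q ∨ Y q + H q ≤ Y p) := by
    have hmix : ∀ (i : {i // Wide i}) (s : {s // s ∈ keep}),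
        (x i.1 + w i.1 ≤ (cell s.1).1 ∨ (cell s.1).2 ≤ x i.1) ∨
        (y i.1 + h i.1 ≤ y (owner s.1) ∨ y (owner s.1) + h (owner s.1) ≤ y i.1) := by
      intro i s
      obtain ⟨b1, -, b2, -⟩ := hcellP s.1
      rcases hitem i.1 (owner s.1) (fun hi => hownW s.1 (hi ▸ i.2)) with (h1 | h1) | h1
      · exact Or.inl (Or.inl (by linarith))
      · exact Or.inl (Or.inr (by linarith))
      · exact Or.inr h1
    rintro (i | s) (j | s') hne
    · exact hitem i.1 j.1 fun hij => hne (by rw [Subtype.ext hij])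
    · simpa [hWdef, hHdef, hYdef, hOdef] using hmix i s'
    · simpa [hWdef, hHdef, hYdef, hOdef, or_comm] using hmix j s
    · simp only [hWdef, hHdef, hYdef, hOdef, Sum.elim_inr, add_sub_cancel]
      have hne' : s.1 ≠ s'.1 := fun hs => hne (by rw [Subtype.ext hs])
      obtain ⟨a1, -, a2, -⟩ := hcellP s.1
      obtain ⟨b1, -, b2, -⟩ := hcellP s'.1
      by_cases ho : owner s.1 = owner s'.1
      · exact Or.inl (hcelldisj _ _ hne' ho)
      · rcases hitem _ _ ho with (h1 | h1) | h1
        · exact Or.inl (Or.inl (by linarith))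
        · exact Or.inl (Or.inr (by linarith))
        · exact Or.inr h1
  have hXmono : ∀ p q, O p + W p ≤ O q → X p + W p ≤ X q := by
    rintro (i | s) (j | s') hpq
    · exact hWW i j hpq
    · exact (hgood _ (hcell0 _) (hkgood s')).2 i hpq
    · simp only [hWdef, hOdef, Sum.elim_inr, Sum.elim_inl, add_sub_cancel] at hpq
      exact hleft _ _ j (hcellP s.1).2.1 hpq
    · simp only [hWdef, hOdef, hXdef, Sum.elim_inr, add_sub_cancel] at hpq ⊢
      have h1 := hgexp _ _ ((hcellP s.1).2.1.le.trans hpq)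
      linarith
  refine ⟨X, Y, ?_, ?_, fun i => ⟨(hXW i).2.2.1, (hXW i).2.2.2⟩⟩
  · rintro (i | s)
    · have h1 := hin i.1
      have h2 := hXW i
      exact ⟨h2.1, (add_le_add_left h2.2.1 _).trans h1.2.1, h1.2.2⟩
    · have h1 := hin (owner s.1)
      refine ⟨(hgood _ (hcell0 _) (hkgood s)).1, ?_, h1.2.2⟩
      have h3 := hgle (cell s.1).1
      have h4 := (hcellP s.1).2.2.1
      change g (cell s.1).1 + ((cell s.1).2 - (cell s.1).1) ≤ 1
      linarith
  · intro p q hpq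
    refine (disjoint_Ioo_prod_iff (by linarith [hWpos p]) (by linarith [hHpos p])
      (by linarith [hWpos q]) (by linarith [hHpos q])).2 ?_
    exact (hOdisj p q hpq).imp_left (Or.imp (hXmono p q) (hXmono q p))
end

section
/- Let ε, ε₁ ∈ (0,1) with 1/(ε·ε₁) ∈ ℤ. Let W, H, S be finite sets of items, where every item of W has width greater than ε₁ and every item of H has height greater than ε₁. Let Ŵ := lingroupWide(W, ε, ε₁) and let Ĥ be obtained from H by the symmetric construction applied to heights. Then there exists a packing of Ŵ ∪ Ĥ ∪ S into fewer than (1 + ε)·opt(W ∪ H ∪ S) + 2 unit square bins in which the items of Ŵ may be sliced by horizontal cuts and the items of Ĥ may be sliced by vertical cuts. -/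
namespace BinPacking

variable {ι κ : Type} [Fintype ι] [Fintype κ]

/-- Packing every item into a bin of its own. -/
theorem nonempty_of_le_one {w h : ι → ℝ} (hw : ∀ i, w i ≤ 1) (hh : ∀ i, h i ≤ 1) :
    Nonempty (BinPacking w h (Fintype.card ι)) :=
  ⟨{ bin := Fintype.equivFin ι
     x := fun _ => 0
     y := fun _ => 0
     x_nonneg := fun _ => le_rfl
     y_nonneg := fun _ => le_rfl
     x_add_le := fun i => by simpa using hw i
     y_add_le := fun i => by simpa using hh i
     disj := fun _ _ hij hb => absurd ((Fintype.equivFin ι).injective hb) hij }⟩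

theorem nonempty_opt {w h : ι → ℝ} (hw : ∀ i, w i ≤ 1) (hh : ∀ i, h i ≤ 1) :
    Nonempty (BinPacking w h (opt w h)) :=
  Nat.sInf_mem (s := {N | Nonempty (BinPacking w h N)}) ⟨_, nonempty_of_le_one hw hh⟩

/-- The total area of the packed items is at most the number of bins. -/
theorem sum_area_le {w h : ι → ℝ} {N : ℕ} (P : BinPacking w h N)
    (hw : ∀ i, 0 ≤ w i) (hh : ∀ i, 0 ≤ h i) : ∑ i, w i * h i ≤ N := by
  classical
  let R : ι → Set (ℝ × ℝ) := fun i =>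
    Set.Ioo (P.x i) (P.x i + w i) ×ˢ Set.Ioo (P.y i) (P.y i + h i)
  have hvol : ∀ i, MeasureTheory.volume (R i) = ENNReal.ofReal (w i * h i) := fun i => by
    rw [MeasureTheory.Measure.volume_eq_prod, MeasureTheory.Measure.prod_prod,
      Real.volume_Ioo, Real.volume_Ioo, ENNReal.ofReal_mul (hw i)]
    simp
  have hbin : ∀ b : Fin N, ∑ i with P.bin i = b, w i * h i ≤ 1 := fun b => by
    have hdisj : Set.PairwiseDisjoint
        (↑(Finset.univ.filter fun i => P.bin i = b)) R := fun i hi j hj hij => by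
      simp only [Finset.coe_filter, Finset.mem_univ, true_and, Set.mem_ofPred_eq] at hi hj
      exact Set.disjoint_iff_inter_eq_empty.2 (P.disj i j hij (hi.trans hj.symm))
    have hsub : (⋃ i ∈ Finset.univ.filter fun i => P.bin i = b, R i) ⊆
        Set.Icc (0 : ℝ) 1 ×ˢ Set.Icc (0 : ℝ) 1 := by
      refine Set.iUnion₂_subset fun i _ => ?_
      rintro ⟨u, v⟩ ⟨⟨hu₁, hu₂⟩, hv₁, hv₂⟩
      have := P.x_nonneg i
      have := P.y_nonneg i
      have := P.x_add_le i
      have := P.y_add_le i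
      exact ⟨⟨by simp only at *; linarith, by simp only at *; linarith⟩,
        ⟨by simp only at *; linarith, by simp only at *; linarith⟩⟩
    have hle := MeasureTheory.measure_mono (μ := MeasureTheory.volume) hsub
    rw [MeasureTheory.measure_biUnion_finset hdisj
      (fun i _ => measurableSet_Ioo.prod measurableSet_Ioo),
      MeasureTheory.Measure.volume_eq_prod (α := ℝ) (β := ℝ),
      MeasureTheory.Measure.prod_prod, Real.volume_Icc] at hle
    rw [← MeasureTheory.Measure.volume_eq_prod (α := ℝ) (β := ℝ)] at hle
    simp only [hvol] at hle
    rw [← ENNReal.ofReal_sum_of_nonneg fun i _ => mul_nonneg (hw i) (hh i)] at hle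
    have hle' : ENNReal.ofReal (∑ i with P.bin i = b, w i * h i) ≤ 1 := by simpa using hle
    exact ENNReal.ofReal_le_one.1 hle'
  calc ∑ i, w i * h i = ∑ b, ∑ i with P.bin i = b, w i * h i :=
        (Finset.sum_fiberwise _ _ _).symm
    _ ≤ ∑ _b : Fin N, (1 : ℝ) := Finset.sum_le_sum fun b _ => hbin b
    _ = N := by simp

/-- Adding further bins, each containing a single unit square. -/
def addUnitBins {w h : ι → ℝ} {N : ℕ} (P : BinPacking w h N) (B : ℕ) :
    BinPacking (Sum.elim w fun _ : Fin B => 1) (Sum.elim h fun _ : Fin B => 1) (N + B) where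
  bin := Sum.elim (fun i => Fin.castAdd B (P.bin i)) (Fin.natAdd N)
  x := Sum.elim P.x fun _ => 0
  y := Sum.elim P.y fun _ => 0
  x_nonneg := by rintro (i | b) <;> simp [P.x_nonneg]
  y_nonneg := by rintro (i | b) <;> simp [P.y_nonneg]
  x_add_le := by rintro (i | b) <;> simp [P.x_add_le]
  y_add_le := by rintro (i | b) <;> simp [P.y_add_le]
  disj := by
    rintro (i | b) (j | b') hij hb
    · exact P.disj i j (fun e => hij (congrArg _ e)) (Fin.castAdd_injective N B hb)
    · have := congrArg Fin.val hb
      have := (P.bin i).isLt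
      simp only [Sum.elim_inl, Sum.elim_inr, Fin.val_castAdd, Fin.val_natAdd] at *
      omega
    · have := congrArg Fin.val hb
      have := (P.bin j).isLt
      simp only [Sum.elim_inl, Sum.elim_inr, Fin.val_castAdd, Fin.val_natAdd] at *
      omega
    · exact absurd (congrArg Sum.inr (Fin.natAdd_injective B N hb)) hij

/-- Replacing every item of a packing by items placed disjointly inside of it. -/
theorem nonempty_of_host {w h : ι → ℝ} {N : ℕ} (P : BinPacking w h N) {w' h' : κ → ℝ}
    (host : κ → ι) (dx dy : κ → ℝ) (hdx : ∀ s, 0 ≤ dx s) (hdy : ∀ s, 0 ≤ dy s)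
    (hw : ∀ s, dx s + w' s ≤ w (host s)) (hh : ∀ s, dy s + h' s ≤ h (host s))
    (hdisj : ∀ s t, s ≠ t → host s = host t →
      dx s + w' s ≤ dx t ∨ dx t + w' t ≤ dx s ∨ dy s + h' s ≤ dy t ∨ dy t + h' t ≤ dy s) :
    Nonempty (BinPacking w' h' N) := by
  refine ⟨{
    bin := fun s => P.bin (host s)
    x := fun s => P.x (host s) + dx s
    y := fun s => P.y (host s) + dy s
    x_nonneg := fun s => add_nonneg (P.x_nonneg _) (hdx s)
    y_nonneg := fun s => add_nonneg (P.y_nonneg _) (hdy s)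
    x_add_le := fun s => by linarith [P.x_add_le (host s), hw s]
    y_add_le := fun s => by linarith [P.y_add_le (host s), hh s]
    disj := fun s t hst hb => ?_ }⟩
  refine Set.eq_empty_of_forall_notMem ?_
  rintro ⟨u, v⟩ ⟨⟨⟨hu₁, hu₂⟩, hv₁, hv₂⟩, ⟨hu₃, hu₄⟩, hv₃, hv₄⟩
  simp only at hu₁ hu₂ hu₃ hu₄ hv₁ hv₂ hv₃ hv₄
  have := hw s
  have := hw t
  have := hh s
  have := hh t
  have := hdx s
  have := hdx t
  have := hdy s
  have := hdy t
  by_cases he : host s = host t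
  · rw [he] at hu₁ hu₂ hv₁ hv₂
    rcases hdisj s t hst he with h | h | h | h <;> linarith
  · refine Set.eq_empty_iff_forall_notMem.1 (P.disj _ _ he hb) (u, v)
      ⟨⟨⟨?_, ?_⟩, ?_, ?_⟩, ⟨?_, ?_⟩, ?_, ?_⟩ <;> simp only <;> linarith

/-- Cutting the first two families of items into slices that are placed either inside of the packed
items or in additional unit bins, horizontal and vertical slices being kept in separate bins. -/
theorem of_slicing {α β γ σ τ : Type} [Fintype α] [Fintype β] [Fintype γ] [Fintype σ] [Fintype τ]
    {w₁ h₁ : α → ℝ} {w₂ h₂ : β → ℝ} {w₃ h₃ : γ → ℝ} {N A B : ℕ}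
    (P : BinPacking (Sum.elim (Sum.elim w₁ w₂) w₃) (Sum.elim (Sum.elim h₁ h₂) h₃) N)
    {ws hs dy : σ → ℝ} {wt ht dx : τ → ℝ} (slot₁ : σ → α ⊕ Fin A) (slot₂ : τ → β ⊕ Fin B)
    (hdy : ∀ s, 0 ≤ dy s) (hdx : ∀ t, 0 ≤ dx t)
    (hhs : ∀ s, dy s + hs s ≤ Sum.elim h₁ (fun _ => 1) (slot₁ s))
    (hwt : ∀ t, dx t + wt t ≤ Sum.elim w₂ (fun _ => 1) (slot₂ t))
    (hws : ∀ s, ws s ≤ Sum.elim w₁ (fun _ => 1) (slot₁ s))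
    (hht : ∀ t, ht t ≤ Sum.elim h₂ (fun _ => 1) (slot₂ t))
    (hdisj₁ : ∀ s t, s ≠ t → slot₁ s = slot₁ t → dy s + hs s ≤ dy t ∨ dy t + hs t ≤ dy s)
    (hdisj₂ : ∀ s t, s ≠ t → slot₂ s = slot₂ t → dx s + wt s ≤ dx t ∨ dx t + wt t ≤ dx s) :
    Nonempty (BinPacking (Sum.elim (Sum.elim ws wt) w₃) (Sum.elim (Sum.elim hs ht) h₃)
      (N + A + B)) := by
  let host₁ : α ⊕ Fin A → (((α ⊕ β) ⊕ γ) ⊕ Fin A) ⊕ Fin B :=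
    fun q => .inl (q.map (fun k => .inl (.inl k)) id)
  let host₂ : β ⊕ Fin B → (((α ⊕ β) ⊕ γ) ⊕ Fin A) ⊕ Fin B :=
    fun q => q.map (fun k => .inl (.inl (.inr k))) id
  have hhost₁ : Function.Injective host₁ := by
    rintro (a | a) (b | b) hab <;> simp_all [host₁]
  have hhost₂ : Function.Injective host₂ := by
    rintro (a | a) (b | b) hab <;> simp_all [host₂]
  have hne : ∀ q q', host₁ q ≠ host₂ q' := by
    rintro (a | a) (b | b) <;> simp [host₁, host₂]
  have hne₁ : ∀ q i, host₁ q ≠ .inl (.inl (.inr i)) := by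
    rintro (a | a) i <;> simp [host₁]
  have hne₂ : ∀ q i, host₂ q ≠ .inl (.inl (.inr i)) := by
    rintro (a | a) i <;> simp [host₂]
  refine ((P.addUnitBins A).addUnitBins B).nonempty_of_host
    (Sum.elim (Sum.elim (fun s => host₁ (slot₁ s)) fun t => host₂ (slot₂ t))
      fun i => .inl (.inl (.inr i)))
    (Sum.elim (Sum.elim (fun _ => 0) dx) fun _ => 0)
    (Sum.elim (Sum.elim dy fun _ => 0) fun _ => 0) ?_ ?_ ?_ ?_ ?_
  · rintro ((s | t) | i)
    exacts [le_rfl, hdx t, le_rfl]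
  · rintro ((s | t) | i)
    exacts [hdy s, le_rfl, le_rfl]
  · rintro ((s | t) | i)
    · have := hws s
      simp only [Sum.elim_inl, host₁, zero_add]
      cases hs : slot₁ s <;> simpa [hs] using this
    · have := hwt t
      simp only [Sum.elim_inl, Sum.elim_inr, host₂]
      cases hs : slot₂ t <;> simpa [hs] using this
    · simp
  · rintro ((s | t) | i)
    · have := hhs s
      simp only [Sum.elim_inl, host₁]
      cases hs : slot₁ s <;> simpa [hs] using this
    · have := hht t
      simp only [Sum.elim_inl, Sum.elim_inr, host₂, zero_add]
      cases hs : slot₂ t <;> simpa [hs] using this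
    · simp
  · rintro ((s | s) | i) ((t | t) | j) hst hhost
    · exact .inr (.inr (hdisj₁ s t (fun h => hst (h ▸ rfl)) (hhost₁ hhost)))
    · exact absurd hhost (hne _ _)
    · exact absurd hhost (hne₁ _ _)
    · exact absurd hhost.symm (hne _ _)
    · exact (hdisj₂ s t (fun h => hst (h ▸ rfl)) (hhost₂ hhost)).imp_right .inl
    · exact absurd hhost (hne₂ _ _)
    · exact absurd hhost.symm (hne₁ _ _)
    · exact absurd hhost.symm (hne₂ _ _)
    · simp only [Sum.elim_inr, Sum.inl.injEq, Sum.inr.injEq] at hhost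
      exact absurd (by rw [hhost]) hst

end BinPacking

theorem Fin.sum_apply_prefix_sub {n : ℕ} (g : Fin n → ℝ) (F : ℝ → ℝ) :
    ∑ l, (F (∑ l' with l' ≤ l, g l') - F (∑ l' with l' < l, g l')) =
      F (∑ l, g l) - F 0 := by
  let P : ℕ → ℝ := fun m => ∑ l' : Fin n with l'.val < m, g l'
  have h : ∀ l : Fin n, F (∑ l' with l' ≤ l, g l') - F (∑ l' with l' < l, g l') =
      F (P (l.val + 1)) - F (P l.val) := fun l => by
    simp only [P, Nat.lt_succ_iff, Fin.le_def, Fin.lt_def]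
  rw [Finset.sum_congr rfl fun l _ => h l,
    Fin.sum_univ_eq_sum_range (fun m => F (P (m + 1)) - F (P m)),
    Finset.sum_range_sub (fun m => F (P m))]
  simp [P]

/-- The length of the intersection of `[a, b]` and `[c, d]`, as a difference of clamped values. -/
theorem max_zero_min_sub_max {a b c d : ℝ} (hab : a ≤ b) (hcd : c ≤ d) :
    max 0 (min b d - max a c) = max a (min b d) - max a (min b c) := by
  grind

/-- `Y i` is the position of item `i` in the stack, ordered by `σ`, of items of heights `h`. -/
def IsStack {n : ℕ} (h : Fin n → ℝ) (σ : Equiv.Perm (Fin n)) (Y : Fin n → ℝ) : Prop :=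
  ∀ i, Y i = ∑ l ∈ Finset.univ.filter (fun l => l < σ.symm i), h (σ l)

namespace IsStack

variable {n : ℕ} {h : Fin n → ℝ} {σ : Equiv.Perm (Fin n)} {Y : Fin n → ℝ}

theorem add_eq (hY : IsStack h σ Y) (i : Fin n) :
    Y i + h i = ∑ l with l ≤ σ.symm i, h (σ l) := by
  have : (Finset.univ.filter fun l => l ≤ σ.symm i) =
      insert (σ.symm i) (Finset.univ.filter fun l => l < σ.symm i) := by
    ext l
    simp [le_iff_eq_or_lt]
  rw [this, Finset.sum_insert (by simp), hY i, Equiv.apply_symm_apply, add_comm]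

theorem nonneg (hY : IsStack h σ Y) (hh : ∀ i, 0 < h i) (i : Fin n) : 0 ≤ Y i := by
  rw [hY i]
  exact Finset.sum_nonneg fun l _ => (hh _).le

theorem add_le_sum (hY : IsStack h σ Y) (hh : ∀ i, 0 < h i) (i : Fin n) :
    Y i + h i ≤ ∑ k, h k := by
  rw [hY.add_eq, ← Equiv.sum_comp σ h]
  exact Finset.sum_le_sum_of_subset_of_nonneg (Finset.subset_univ _) fun l _ _ => (hh _).le

theorem add_le_of_lt (hY : IsStack h σ Y) (hh : ∀ i, 0 < h i) {i k : Fin n}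
    (hik : σ.symm i < σ.symm k) : Y i + h i ≤ Y k := by
  rw [hY.add_eq, hY k]
  refine Finset.sum_le_sum_of_subset_of_nonneg (fun l hl => ?_) fun l _ _ => (hh _).le
  simp only [Finset.mem_filter, Finset.mem_univ, true_and] at hl ⊢
  exact hl.trans_lt hik

theorem sum_apply_sub (hY : IsStack h σ Y) (F : ℝ → ℝ) :
    ∑ i, (F (Y i + h i) - F (Y i)) = F (∑ i, h i) - F 0 := by
  rw [← Equiv.sum_comp σ h, ← Fin.sum_apply_prefix_sub, ← Equiv.sum_comp σ]
  refine Finset.sum_congr rfl fun l _ => ?_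
  rw [hY.add_eq, hY (σ l), Equiv.symm_apply_apply]

end IsStack

/-- If `t` is an inner point of the stack interval of `i`, then the rounded width of `i` is at most
the width of some item that does not end before position `t - D` of the stack. -/
theorem exists_section_of_mem_stack {n M : ℕ} {D : ℝ} {w h Y r : Fin n → ℝ} {g : ℕ → ℝ}
    (hD : 0 < D) (hYnonneg : ∀ i, 0 ≤ Y i)
    (hYle : ∀ i, Y i + h i ≤ M * D)
    (hg : ∀ j, g j = sSup {v : ℝ | ∃ i : Fin n, v = w i ∧
      (Set.Ioo (Y i) (Y i + h i) ∩ Set.Ioo (((j : ℝ) - 1) * D) ((j : ℝ) * D)).Nonempty})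
    (hr : ∀ i, r i = sInf {v : ℝ | (∃ j ∈ Finset.Icc 1 M, v = g j) ∧ w i ≤ v})
    {i : Fin n} {t : ℝ} (ht : t ∈ Set.Ioo (Y i) (Y i + h i)) :
    ∃ i', r i ≤ w i' ∧ t - D < Y i' + h i' := by
  obtain ⟨ht₁, ht₂⟩ := ht
  have htpos : 0 < t := (hYnonneg i).trans_lt ht₁
  set j := ⌈t / D⌉₊ with hj
  have hj₁ : 1 ≤ j := Nat.one_le_ceil_iff.2 (div_pos htpos hD)
  have hjM : j ≤ M := Nat.ceil_le.2 ((div_le_iff₀ hD).2 (ht₂.le.trans (hYle i)))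
  have htj : t ≤ j * D := (div_le_iff₀ hD).1 (Nat.le_ceil _)
  have hjt : ((j : ℝ) - 1) * D < t := by
    rw [← lt_div_iff₀ hD]
    linarith [Nat.ceil_lt_add_one (div_pos htpos hD).le]
  set A : Set ℝ := {v : ℝ | ∃ i : Fin n, v = w i ∧
      (Set.Ioo (Y i) (Y i + h i) ∩ Set.Ioo (((j : ℝ) - 1) * D) ((j : ℝ) * D)).Nonempty}
  have hmem : w i ∈ A := by
    obtain ⟨s, hs₁, hs₂⟩ := exists_between (max_lt ht₁ hjt)
    exact ⟨i, rfl, s, ⟨(le_max_left _ _).trans_lt hs₁, hs₂.trans ht₂⟩,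
      (le_max_right _ _).trans_lt hs₁, hs₂.trans_le htj⟩
  have hfin : A.Finite :=
    (Set.finite_range w).subset (by rintro _ ⟨i, rfl, -⟩; exact ⟨i, rfl⟩)
  have hri : r i ≤ g j := by
    rw [hr i]
    refine csInf_le ⟨w i, fun v hv => hv.2⟩ ⟨⟨j, Finset.mem_Icc.2 ⟨hj₁, hjM⟩, rfl⟩, ?_⟩
    rw [hg j]
    exact le_csSup hfin.bddAbove hmem
  obtain ⟨i', hi', s, ⟨-, hs₂⟩, hs₃, -⟩ := Set.Nonempty.csSup_mem ⟨_, hmem⟩ hfin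
  refine ⟨i', by rw [← hi', ← hg j]; exact hri, ?_⟩
  linarith

/-- Slicing the items of a stack after linear grouping. With groups of height `D`, the rounded
items can be sliced so that every slice is either assigned to an item `k` of the original stack
that is at least as wide, or to one of `⌈D⌉₊` additional unit squares, with the slices assigned to
the same place being stacked without overlap. -/
theorem exists_slicing {n M : ℕ} {D : ℝ} {w h Y r : Fin n → ℝ} {g : ℕ → ℝ}
    {σ : Equiv.Perm (Fin n)} (hdims : ∀ i, 0 < w i ∧ w i ≤ 1 ∧ 0 < h i ∧ h i ≤ 1)
    (hσ : ∀ k l : Fin n, k ≤ l → w (σ l) ≤ w (σ k)) (hY : IsStack h σ Y)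
    (hMD : M * D = ∑ i, h i)
    (hg : ∀ j, g j = sSup {v : ℝ | ∃ i : Fin n, v = w i ∧
      (Set.Ioo (Y i) (Y i + h i) ∩ Set.Ioo (((j : ℝ) - 1) * D) ((j : ℝ) * D)).Nonempty})
    (hr : ∀ i, r i = sInf {v : ℝ | (∃ j ∈ Finset.Icc 1 M, v = g j) ∧ w i ≤ v}) :
    ∃ (m : ℕ) (f : Fin m → Fin n) (sh off : Fin m → ℝ) (slot : Fin m → Fin n ⊕ Fin ⌈D⌉₊),
      (∀ s, 0 < sh s) ∧
      (∀ j, ∑ s ∈ Finset.univ.filter (fun s => f s = j), sh s = h j) ∧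
      (∀ s, 0 ≤ off s) ∧
      (∀ s, off s + sh s ≤ Sum.elim h (fun _ => 1) (slot s)) ∧
      (∀ s, r (f s) ≤ Sum.elim w (fun _ => 1) (slot s)) ∧
      (∀ s t, s ≠ t → slot s = slot t → off s + sh s ≤ off t ∨ off t + sh t ≤ off s) := by
  classical
  have hpos : ∀ i, 0 < h i := fun i => (hdims i).2.2.1
  have hYle : ∀ i, Y i + h i ≤ M * D := fun i => hMD ▸ hY.add_le_sum hpos i
  have hYnonneg := hY.nonneg hpos
  have hDpos : Fin n → 0 < D := fun i =>
    pos_of_mul_pos_right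
      ((add_pos_of_nonneg_of_pos (hYnonneg i) (hpos i)).trans_le (hYle i)) M.cast_nonneg
  have hsec : ∀ i t, t ∈ Set.Ioo (Y i) (Y i + h i) →
      ∃ i', r i ≤ w i' ∧ t - D < Y i' + h i' := fun i t ht =>
    exists_section_of_mem_stack (hDpos i) hYnonneg hYle hg hr ht
  let lo : Fin n ⊕ Fin ⌈D⌉₊ → ℝ := Sum.elim (fun k => Y k + D) fun b => min b D
  let hi : Fin n ⊕ Fin ⌈D⌉₊ → ℝ := Sum.elim (fun k => Y k + h k + D) fun b => min (b + 1) D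
  have hlohi : ∀ q, lo q ≤ hi q := by
    rintro (k | b)
    · simp only [lo, hi, Sum.elim_inl]
      linarith [hpos k]
    · exact min_le_min_right _ (by linarith)
  have hlen : ∀ q, hi q - lo q ≤ Sum.elim h (fun _ => 1) q := by
    rintro (k | b)
    · simp only [lo, hi, Sum.elim_inl]
      linarith
    · simp only [lo, hi, Sum.elim_inr]
      grind
  let T := {p : Fin n × (Fin n ⊕ Fin ⌈D⌉₊) //
    max (Y p.1) (lo p.2) < min (Y p.1 + h p.1) (hi p.2)}
  let len : Fin n × (Fin n ⊕ Fin ⌈D⌉₊) → ℝ := fun p =>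
    min (Y p.1 + h p.1) (hi p.2) - max (Y p.1) (lo p.2)
  let e : Fin (Fintype.card T) ≃ T := (Fintype.equivFin T).symm
  have hsum : ∀ i, ∑ q, max 0 (len (i, q)) = h i := fun i => by
    let F : ℝ → ℝ := fun u => max (Y i) (min (Y i + h i) u)
    have hF : ∀ q, max 0 (len (i, q)) = F (hi q) - F (lo q) := fun q =>
      max_zero_min_sub_max (by linarith [hpos i]) (hlohi q)
    have hinl : ∑ k : Fin n, (F (Y k + h k + D) - F (Y k + D)) =
        F (∑ k, h k + D) - F (0 + D) := hY.sum_apply_sub fun u => F (u + D)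
    have hinr : ∑ b : Fin ⌈D⌉₊, (F (min ((b : ℝ) + 1) D) - F (min (b : ℝ) D)) =
        F D - F 0 := by
      have := Fin.sum_univ_eq_sum_range (n := ⌈D⌉₊)
        (fun b : ℕ => F (min ((b : ℝ) + 1) D) - F (min (b : ℝ) D))
      rw [this]
      have := Finset.sum_range_sub (fun b : ℕ => F (min (b : ℝ) D)) ⌈D⌉₊
      simp only [Nat.cast_add, Nat.cast_one, Nat.cast_zero] at this
      rw [this, min_eq_right (Nat.le_ceil D), min_eq_left (hDpos i).le]
    rw [Finset.sum_congr rfl fun q _ => hF q, Fintype.sum_sum_type]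
    simp only [lo, hi, Sum.elim_inl, Sum.elim_inr]
    rw [hinl, hinr, zero_add, sub_add_sub_cancel, ← hMD]
    have h₁ := hYle i
    have h₂ := hYnonneg i
    have h₃ := hpos i
    have h₄ := hDpos i
    simp only [F]
    grind
  refine ⟨Fintype.card T, fun s => (e s).1.1, fun s => len (e s).1,
    fun s => max (Y (e s).1.1) (lo (e s).1.2) - lo (e s).1.2, fun s => (e s).1.2,
    fun s => sub_pos.2 (e s).2, fun i => ?_, fun s => sub_nonneg.2 (le_max_right _ _),
    fun s => ?_, fun s => ?_, fun s t hst hslot => ?_⟩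
  · rw [Finset.sum_filter, Equiv.sum_comp e fun p : T => if p.1.1 = i then len p.1 else 0,
      ← hsum i]
    have h₁ := Finset.sum_subtype (F := inferInstanceAs (Fintype T))
      (p := fun p : Fin n × (Fin n ⊕ Fin ⌈D⌉₊) =>
        max (Y p.1) (lo p.2) < min (Y p.1 + h p.1) (hi p.2))
      (Finset.univ.filter fun p => max (Y p.1) (lo p.2) < min (Y p.1 + h p.1) (hi p.2))
      (fun p => by rw [Finset.mem_filter, and_iff_right (Finset.mem_univ p)])
      (fun p => if p.1 = i then len p else 0)
    rw [← h₁, Finset.sum_filter, Fintype.sum_prod_type, Finset.sum_eq_single i]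
    · refine Finset.sum_congr rfl fun q _ => ?_
      simp only [len, if_true]
      split_ifs with hlt
      · exact (max_eq_right (sub_pos.2 hlt).le).symm
      · exact (max_eq_left (sub_nonpos.2 (not_lt.1 hlt))).symm
    · intro k _ hk
      simp [hk]
    · simp
  · refine le_trans ?_ (hlen _)
    simp only [len]
    linarith [min_le_right (Y (e s).1.1 + h (e s).1.1) (hi (e s).1.2)]
  · simp only
    obtain ⟨⟨i, q⟩, hp⟩ := e s
    obtain ⟨t, ht₁, ht₂⟩ := exists_between hp
    rw [max_lt_iff] at ht₁
    rw [lt_min_iff] at ht₂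
    obtain ⟨i', hi', hlt⟩ := hsec i t ⟨ht₁.1, ht₂.1⟩
    refine hi'.trans ?_
    rcases q with k | b
    · have hk : σ.symm k ≤ σ.symm i' := by
        by_contra! hcon
        have h₁ := hY.add_le_of_lt hpos hcon
        have h₂ := ht₁.2
        simp only [lo, Sum.elim_inl] at h₂
        linarith
      simpa using hσ _ _ hk
    · exact (hdims i').2.1
  · have hne : (e s).1.1 ≠ (e t).1.1 := fun he =>
      hst (e.injective (Subtype.ext (Prod.ext he hslot)))
    simp only at hslot
    simp only [len]
    rw [hslot]
    have hs₁ := min_le_left (Y (e s).1.1 + h (e s).1.1) (hi (e t).1.2)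
    have hs₂ := le_max_left (Y (e s).1.1) (lo (e t).1.2)
    have ht₁ := min_le_left (Y (e t).1.1 + h (e t).1.1) (hi (e t).1.2)
    have ht₂ := le_max_left (Y (e t).1.1) (lo (e t).1.2)
    rcases lt_or_gt_of_ne (σ.symm.injective.ne hne) with hlt | hlt
    · left
      linarith [hY.add_le_of_lt hpos hlt]
    · right
      linarith [hY.add_le_of_lt hpos hlt]

/-- Linear grouping: let `Ŵ` be obtained from the wide
items `W` by rounding each width up to the smallest section-maximum width
`g_W(j)` (over the `1/(ε·ε₁)` sections of the width-sorted stack of `W`), and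
let `Ĥ` be obtained symmetrically from the tall items `H`. Then the rounded
items `Ŵ ∪ Ĥ ∪ S` — with `Ŵ` sliceable by horizontal cuts and `Ĥ` sliceable
by vertical cuts — can be packed into fewer than
`(1 + ε)·opt(W ∪ H ∪ S) + 2` unit square bins. -/
theorem lingroup_repack
    (ε ε₁ : ℝ) (hε0 : 0 < ε) (hε1 : ε < 1) (hε₁0 : 0 < ε₁) (hε₁1 : ε₁ < 1)
    (M : ℕ) (hM : (M : ℝ) = 1/(ε*ε₁))
    (nW nH nS : ℕ)
    (wW hW : Fin nW → ℝ) (wH hH : Fin nH → ℝ) (wS hS : Fin nS → ℝ)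
    (hWdims : ∀ i, 0 < wW i ∧ wW i ≤ 1 ∧ 0 < hW i ∧ hW i ≤ 1)
    (hHdims : ∀ i, 0 < wH i ∧ wH i ≤ 1 ∧ 0 < hH i ∧ hH i ≤ 1)
    (hSdims : ∀ i, 0 < wS i ∧ wS i ≤ 1 ∧ 0 < hS i ∧ hS i ≤ 1)
    (hWwide : ∀ i, ε₁ < wW i) (hHtall : ∀ i, ε₁ < hH i)
    -- the stack of wide items, ordered by decreasing width
    (σ : Equiv.Perm (Fin nW)) (hσ : ∀ k l : Fin nW, k ≤ l → wW (σ l) ≤ wW (σ k))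
    (Y : Fin nW → ℝ)
    (hY : ∀ i, Y i = ∑ l ∈ Finset.univ.filter (fun l => l < σ.symm i), hW (σ l))
    -- gW j = width of the widest item meeting the j-th section of the stack
    (gW : ℕ → ℝ)
    (hgW : ∀ j, gW j = sSup {v : ℝ | ∃ i : Fin nW, v = wW i ∧
      (Set.Ioo (Y i) (Y i + hW i) ∩
        Set.Ioo (((j:ℝ) - 1) * (ε*ε₁) * (∑ i, hW i))
          ((j:ℝ) * (ε*ε₁) * (∑ i, hW i))).Nonempty})
    -- rounded widths: smallest gW j that is at least the width of the item
    (wRound : Fin nW → ℝ)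
    (hwRound : ∀ i, wRound i =
      sInf {v : ℝ | (∃ j ∈ Finset.Icc 1 M, v = gW j) ∧ wW i ≤ v})
    -- the symmetric construction for the tall items
    (τ : Equiv.Perm (Fin nH)) (hτ : ∀ k l : Fin nH, k ≤ l → hH (τ l) ≤ hH (τ k))
    (X : Fin nH → ℝ)
    (hX : ∀ i, X i = ∑ l ∈ Finset.univ.filter (fun l => l < τ.symm i), wH (τ l))
    (gH : ℕ → ℝ)
    (hgH : ∀ j, gH j = sSup {v : ℝ | ∃ i : Fin nH, v = hH i ∧
      (Set.Ioo (X i) (X i + wH i) ∩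
        Set.Ioo (((j:ℝ) - 1) * (ε*ε₁) * (∑ i, wH i))
          ((j:ℝ) * (ε*ε₁) * (∑ i, wH i))).Nonempty})
    (hRound : Fin nH → ℝ)
    (hhRound : ∀ i, hRound i =
      sInf {v : ℝ | (∃ j ∈ Finset.Icc 1 M, v = gH j) ∧ hH i ≤ v}) :
    -- conclusion: a packing of a horizontal slicing of Ŵ, a vertical slicing
    -- of Ĥ, and the small items S into < (1+ε)·opt(W ∪ H ∪ S) + 2 bins
    ∃ (mW mH : ℕ) (fW : Fin mW → Fin nW) (fH : Fin mH → Fin nH)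
      (sh : Fin mW → ℝ) (sw : Fin mH → ℝ),
      (∀ s, 0 < sh s) ∧ (∀ s, 0 < sw s) ∧
      (∀ j, ∑ s ∈ Finset.univ.filter (fun s => fW s = j), sh s = hW j) ∧
      (∀ j, ∑ s ∈ Finset.univ.filter (fun s => fH s = j), sw s = wH j) ∧
      ∃ N : ℕ,
        Nonempty (BinPacking
          (Sum.elim (Sum.elim (fun s => wRound (fW s)) sw) wS)
          (Sum.elim (Sum.elim sh (fun s => hRound (fH s))) hS) N) ∧
        (N : ℝ) < (1 + ε) *
          (opt (Sum.elim (Sum.elim wW wH) wS) (Sum.elim (Sum.elim hW hH) hS) : ℝ)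
          + 2 := by
  have hc : 0 < ε * ε₁ := mul_pos hε0 hε₁0
  have hMc : (M : ℝ) * (ε * ε₁) = 1 := by rw [hM, one_div, inv_mul_cancel₀ hc.ne']
  simp only [mul_assoc _ (ε * ε₁)] at hgW hgH
  set DW := ε * ε₁ * ∑ i, hW i with hDWdef
  set DH := ε * ε₁ * ∑ i, wH i with hDHdef
  obtain ⟨mW, fW, sh, offW, slotW, hsh, hsumW, hoffW, hlenW, hroundW, hdisjW⟩ :=
    exists_slicing hWdims hσ hY (by rw [hDWdef, ← mul_assoc, hMc, one_mul]) hgW hwRound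
  obtain ⟨mH, fH, sw, offH, slotH, hsw, hsumH, hoffH, hlenH, hroundH, hdisjH⟩ :=
    exists_slicing (fun i => ⟨(hHdims i).2.2.1, (hHdims i).2.2.2, (hHdims i).1, (hHdims i).2.1⟩)
      hτ hX (by rw [hDHdef, ← mul_assoc, hMc, one_mul]) hgH hhRound
  have hDW : 0 ≤ DW := mul_nonneg hc.le (Finset.sum_nonneg fun i _ => (hWdims i).2.2.1.le)
  have hDH : 0 ≤ DH := mul_nonneg hc.le (Finset.sum_nonneg fun i _ => (hHdims i).1.le)
  obtain ⟨P⟩ := BinPacking.nonempty_opt (w := Sum.elim (Sum.elim wW wH) wS)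
    (h := Sum.elim (Sum.elim hW hH) hS)
    (by rintro ((i | i) | i)
        exacts [(hWdims i).2.1, (hHdims i).2.1, (hSdims i).2.1])
    (by rintro ((i | i) | i)
        exacts [(hWdims i).2.2.2, (hHdims i).2.2.2, (hSdims i).2.2.2])
  set N := opt (Sum.elim (Sum.elim wW wH) wS) (Sum.elim (Sum.elim hW hH) hS)
  have harea : ε₁ * ∑ i, hW i + ε₁ * ∑ i, wH i ≤ N := by
    have h₁ := P.sum_area_le
      (by rintro ((i | i) | i)
          exacts [(hWdims i).1.le, (hHdims i).1.le, (hSdims i).1.le])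
      (by rintro ((i | i) | i)
          exacts [(hWdims i).2.2.1.le, (hHdims i).2.2.1.le, (hSdims i).2.2.1.le])
    simp only [Fintype.sum_sum_type, Sum.elim_inl, Sum.elim_inr] at h₁
    have h₂ : ε₁ * ∑ i, hW i ≤ ∑ i, wW i * hW i := by
      rw [Finset.mul_sum]
      exact Finset.sum_le_sum fun i _ =>
        mul_le_mul_of_nonneg_right (hWwide i).le (hWdims i).2.2.1.le
    have h₃ : ε₁ * ∑ i, wH i ≤ ∑ i, wH i * hH i := by
      rw [Finset.mul_sum]
      refine Finset.sum_le_sum fun i _ => ?_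
      rw [mul_comm]
      exact mul_le_mul_of_nonneg_left (hHtall i).le (hHdims i).1.le
    have h₄ : 0 ≤ ∑ i, wS i * hS i :=
      Finset.sum_nonneg fun i _ => mul_nonneg (hSdims i).1.le (hSdims i).2.2.1.le
    linarith
  refine ⟨mW, mH, fW, fH, sh, sw, hsh, hsw, hsumW, hsumH, N + ⌈DW⌉₊ + ⌈DH⌉₊, ?_, ?_⟩
  · exact P.of_slicing slotW slotH hoffW hoffH hlenW hlenH hroundW hroundH hdisjW hdisjH
  · have h₁ := Nat.ceil_lt_add_one hDW
    have h₂ := Nat.ceil_lt_add_one hDH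
    have h₃ : DW + DH ≤ ε * N := by
      have := mul_le_mul_of_nonneg_left harea hε0.le
      simp only [DW, DH]
      linarith
    push_cast
    linarith
end
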